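/- Let p = p(k) satisfy k^{-3/2} ≪ p(k) (i.e. p(k)·k^{3/2} → ∞) and p(k) ≤ 10·(ln k)/k. Then the conditional distribution of M given TREE satisfies a central limit theorem with the unconditioned mean and variance: for every fixed real u, Pr[M* ≤ μ + uσ] → Φ(u) as k → ∞, where Φ is the standard normal distribution function. -/

import Mathlib

open Filter Topology Real Finset

-- Indicator of a proposition, as a real number.
open Classical in
noncomputable def ind (P : Prop) : ℝ := if P then 1 else 0

/-- Weight of a placement `T` of the `k-1` balls into the `k` bins under the tilted
(truncated geometric) distribution. -/
noncomputable def wt (k : ℕ) (p : ℝ) (T : Fin (k - 1) → Fin k) : ℝ :=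
  ∏ j, p * (1 - p) ^ ((T j : ℕ)) / (1 - (1 - p) ^ k)

/-- The event TREE: `Y_t > 0` for all `1 ≤ t ≤ k-1`. -/
def TREEevt (k : ℕ) (T : Fin (k - 1) → Fin k) : Prop :=
  ∀ t, 1 ≤ t → t ≤ k - 1 →
    t ≤ (Finset.univ.filter (fun j => ((T j : ℕ) < t))).card

/-- `Pr[TREE]`. -/
noncomputable def treeProb (k : ℕ) (p : ℝ) : ℝ :=
  ∑ T : Fin (k - 1) → Fin k, wt k p T * ind (TREEevt k T)

/-- `M = C(k,2) - ∑_j T_j`. -/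
def Mval (k : ℕ) (T : Fin (k - 1) → Fin k) : ℤ :=
  (Nat.choose k 2 : ℤ) - ∑ j, ((T j : ℕ) + 1 : ℤ)

/-- `μ = E[M]`, the mean of the unconditioned `M`. -/
noncomputable def muM (k : ℕ) (p : ℝ) : ℝ :=
  ∑ T : Fin (k - 1) → Fin k, wt k p T * (Mval k T : ℝ)

/-- `σ² = Var(M)`, the variance of the unconditioned `M`. -/
noncomputable def varM (k : ℕ) (p : ℝ) : ℝ :=
  ∑ T : Fin (k - 1) → Fin k, wt k p T * ((Mval k T : ℝ) - muM k p) ^ 2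

/-- The conditional distribution function of `M` given TREE:
`Pr[M* ≤ x] = Pr[M ≤ x ∧ TREE] / Pr[TREE]`. -/
noncomputable def condCDF_M (k : ℕ) (p : ℝ) (x : ℝ) : ℝ :=
  (∑ T : Fin (k - 1) → Fin k, wt k p T * ind (TREEevt k T ∧ (Mval k T : ℝ) ≤ x)) /
    treeProb k p

/-- The standard normal distribution function `Φ`. -/
noncomputable def stdGaussCDF (u : ℝ) : ℝ :=
  ∫ t in Set.Iic u, Real.exp (-t ^ 2 / 2) / Real.sqrt (2 * Real.pi)



/-- number of balls in bins `≤ t` -/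
def cnt {n k : ℕ} (T : Fin n → Fin k) (t : Fin k) : ℕ :=
  (Finset.univ.filter (fun j => T j ≤ t)).card

lemma cnt_le {n k : ℕ} (T : Fin n → Fin k) (t : Fin k) : cnt T t ≤ n := by
  unfold cnt
  exact (Finset.card_le_univ _).trans (by simp)

lemma cnt_mono {n k : ℕ} (T : Fin n → Fin k) : Monotone (cnt T) := by
  intro a b hab
  unfold cnt
  apply Finset.card_le_card
  intro j
  simp only [Finset.mem_filter, Finset.mem_univ, true_and]
  exact fun h => h.trans hab

lemma sum_eq_cnt {n k : ℕ} (T : Fin n → Fin k) :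
    ∑ j, (T j : ℕ) = ∑ t, (n - cnt T t) := by
  have h1 : ∀ t, n - cnt T t = ∑ j, if t < T j then 1 else 0 := by
    intro t
    rw [← Finset.card_filter]
    have := Finset.card_filter_add_card_filter_not (s := (Finset.univ : Finset (Fin n)))
      (fun j => T j ≤ t)
    simp only [not_le, Finset.card_univ, Fintype.card_fin] at this
    unfold cnt
    omega
  simp_rw [h1]
  rw [Finset.sum_comm]
  apply Finset.sum_congr rfl
  intro j _
  rw [← Finset.card_filter]
  have : (Finset.univ.filter (fun t => t < T j)) = Finset.Iio (T j) := by ext; simp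
  rw [this, Fin.card_Iio]

/-- the basic weighted sum -/
noncomputable def SS (n k : ℕ) (q : ℝ) (F : (Fin k → ℕ) → ℝ) : ℝ :=
  ∑ T : Fin n → Fin k, q ^ (∑ j, (T j : ℕ)) * F (cnt T)

lemma fiber_count {k : ℕ} (n : ℕ) : ∀ (z : Fin k → ℕ), ∑ i, z i = n →
    (Finset.univ.filter (fun T : Fin n → Fin k =>
      ∀ i, (Finset.univ.filter (fun j => T j = i)).card = z i)).card * ∏ i, (z i).factorial
      = n.factorial := by
  induction n with
  | zero =>
    intro z hz
    have hz0 : ∀ i, z i = 0 := by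
      intro i
      exact (Finset.sum_eq_zero_iff.1 hz) i (Finset.mem_univ i)
    simp [hz0]
  | succ n ih =>
    intro z hz
    have key : (Finset.univ.filter (fun T : Fin (n+1) → Fin k =>
        ∀ i, (Finset.univ.filter (fun j => T j = i)).card = z i)).card
        = ∑ a : Fin k, if z a = 0 then 0 else
          (Finset.univ.filter (fun T : Fin n → Fin k =>
          ∀ i, (Finset.univ.filter (fun j => T j = i)).card
            = (Function.update z a (z a - 1)) i)).card := by
      rw [Finset.card_filter]
      rw [← (Fin.consEquiv (fun _ : Fin (n+1) => Fin k)).sum_comp]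
      rw [Fintype.sum_prod_type]
      apply Finset.sum_congr rfl
      intro a _
      rw [← Finset.card_filter]
      split_ifs with h0
      · rw [Finset.card_eq_zero, Finset.filter_eq_empty_iff]
        intro T _ h
        have := h a
        rw [h0, Finset.card_eq_zero, Finset.filter_eq_empty_iff] at this
        exact this (Finset.mem_univ 0) (by simp [Fin.consEquiv])
      · congr 1
        ext T
        simp only [Finset.mem_filter, Finset.mem_univ, true_and]
        apply forall_congr'
        intro i
        rw [Fin.card_filter_univ_succ]
        simp only [Fin.consEquiv, Equiv.coe_fn_mk, Fin.cons_zero, Fin.cons_succ]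
        by_cases hi : a = i
        · subst hi
          simp only [if_true, Function.update_self, Function.comp_def, Fin.cons_succ]
          omega
        · simp only [if_neg hi, Function.update_of_ne (Ne.symm hi), Function.comp_def, Fin.cons_succ]
    rw [key, Finset.sum_mul]
    have : ∀ a : Fin k, (if z a = 0 then 0 else
          (Finset.univ.filter (fun T : Fin n → Fin k =>
          ∀ i, (Finset.univ.filter (fun j => T j = i)).card
            = (Function.update z a (z a - 1)) i)).card) * ∏ i, (z i).factorial
            = z a * n.factorial := by
      intro a
      split_ifs with h0
      · simp [h0]
      · have hs : ∑ i, (Function.update z a (z a - 1)) i = n := by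
          rw [Finset.sum_update_of_mem (Finset.mem_univ a)]
          rw [← Finset.add_sum_erase _ _ (Finset.mem_univ a)] at hz
          rw [Finset.sdiff_singleton_eq_erase]
          omega
        have hp : ∏ i, (z i).factorial = z a * ∏ i, (Function.update z a (z a - 1) i).factorial := by
          rw [← Finset.mul_prod_erase _ _ (Finset.mem_univ a),
            ← Finset.mul_prod_erase (a := a) Finset.univ
              (fun i => (Function.update z a (z a - 1) i).factorial) (Finset.mem_univ a)]
          rw [Function.update_self, ← mul_assoc, Nat.mul_factorial_pred h0]
          congr 1
          apply Finset.prod_congr rfl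
          intro i hi
          rw [Function.update_of_ne (Finset.ne_of_mem_erase hi)]
        rw [hp, mul_left_comm, ih _ hs]
    simp_rw [this]
    rw [← Finset.sum_mul, hz, Nat.factorial_succ]

lemma fact_conv (s d e : ℕ) : (s + d).factorial * (s + e).factorial
    ≤ s.factorial * (s + d + e).factorial := by
  induction e with
  | zero => simp [mul_comm]
  | succ e ih =>
    rw [← add_assoc, ← add_assoc, Nat.factorial_succ, Nat.factorial_succ]
    calc (s+d).factorial * ((s+e+1) * (s+e).factorial)
        = (s+e+1) * ((s+d).factorial * (s+e).factorial) := by ring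
      _ ≤ (s+d+e+1) * (s.factorial * (s+d+e).factorial) := by
          apply Nat.mul_le_mul _ ih; omega
      _ = _ := by ring

lemma fact_minmax (a b a' b' : ℕ) (ha : a' ≤ a) (hb : b' ≤ b) :
    (min a b - min a' b').factorial * (max a b - max a' b').factorial
     ≤ (a - a').factorial * (b - b').factorial := by
  wlog h : a ≤ b generalizing a b a' b'
  · have := this b a b' a' hb ha (by omega)
    rw [min_comm a b, max_comm a b, min_comm a' b', max_comm a' b', mul_comm (Nat.factorial (a-a'))]
    exact this
  rw [min_eq_left h, max_eq_right h]
  rcases le_total a' b' with h' | h'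
  · rw [min_eq_left h', max_eq_right h']
  · rw [min_eq_right h', max_eq_left h']
    have := fact_conv (a - a') (a' - b') (b - a)
    rw [show a - a' + (a' - b') = a - b' by omega, show a - a' + (b - a) = b - a' by omega,
      show a - b' + (b - a) = b - b' by omega] at this
    exact this


def prv {k : ℕ} (c : Fin k → ℕ) (i : Fin k) : ℕ :=
  if h : (i : ℕ) = 0 then 0 else c ⟨(i : ℕ) - 1, by omega⟩

def validC {k : ℕ} (n : ℕ) (c : Fin k → ℕ) : Prop :=
  (∀ i, prv c i ≤ c i) ∧ ∀ i : Fin k, (i : ℕ) + 1 = k → c i = n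

lemma cnt_eq_prv {n k : ℕ} (T : Fin n → Fin k) (i : Fin k) :
    cnt T i = prv (cnt T) i + (Finset.univ.filter (fun j => T j = i)).card := by
  unfold prv
  split_ifs with h
  · rw [zero_add]
    unfold cnt
    congr 1
    ext j
    simp only [Finset.mem_filter, Finset.mem_univ, true_and, Fin.le_def, Fin.ext_iff]
    omega
  · unfold cnt
    rw [← Finset.card_union_of_disjoint]
    · congr 1
      ext j
      simp only [Finset.mem_filter, Finset.mem_univ, true_and, Fin.le_def, Fin.ext_iff,
        Finset.mem_union]
      omega
    · rw [Finset.disjoint_left]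
      intro j
      simp only [Finset.mem_filter, Finset.mem_univ, true_and, Fin.le_def, Fin.ext_iff]
      omega

lemma cnt_valid {n k : ℕ} (T : Fin n → Fin k) : validC n (cnt T) := by
  refine ⟨fun i => ?_, fun i hi => ?_⟩
  · have := cnt_eq_prv T i
    omega
  · unfold cnt
    rw [Finset.filter_true_of_mem]
    · simp
    · intro j _
      rw [Fin.le_def]
      omega

lemma sum_valid {n k : ℕ} (hk : 0 < k) (c : Fin k → ℕ) (hc : validC n c) :
    ∑ i, (c i - prv c i) = n := by
  let f : ℕ → ℕ := fun t => if h : t = 0 then 0 else if h' : t - 1 < k then c ⟨t - 1, h'⟩ else n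
  have hlast : c ⟨k - 1, by omega⟩ = n := hc.2 _ (by simp; omega)
  have hf : Monotone f := by
    apply monotone_nat_of_le_succ
    intro t
    by_cases h : t < k
    · have := hc.1 ⟨t, h⟩
      by_cases ht : t = 0
      · simp [f, ht]
      · simp only [prv, ht, dif_neg, not_false_eq_true] at this
        simp only [f, ht, dif_neg, not_false_eq_true, show t - 1 < k by omega, dif_pos,
          Nat.add_sub_cancel, h, Nat.succ_ne_zero, Nat.add_eq_zero_iff, false_and]
        exact this
    · by_cases h2 : t = k
      · subst h2
        have h3 : ¬ (t = 0) := by omega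
        simp only [f, h3, dif_neg, not_false_eq_true, show t - 1 < t by omega, dif_pos, hlast,
          Nat.add_sub_cancel, h, Nat.add_eq_zero_iff, false_and, le_refl]
      · have h3 : ¬ (t = 0) := by omega
        simp only [f, h3, dif_neg, not_false_eq_true, show ¬ (t - 1 < k) by omega,
          Nat.add_sub_cancel, h, Nat.add_eq_zero_iff, false_and, le_refl]
  have h1 : ∀ i : Fin k, c i - prv c i = f ((i:ℕ)+1) - f i := by
    intro i
    have e1 : f ((i:ℕ)+1) = c i := by simp [f]
    have e2 : f i = prv c i := by
      unfold prv
      by_cases h : (i:ℕ) = 0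
      · simp [f, h]
      · simp only [f, h, dif_neg, not_false_eq_true, show (i:ℕ) - 1 < k by omega, dif_pos]
    rw [e1, e2]
  simp_rw [h1]
  rw [Fin.sum_univ_eq_sum_range (fun i => f (i+1) - f i) k, Finset.sum_range_tsub hf]
  have : f k = n := by
    have h3 : ¬ (k = 0) := by omega
    simp only [f, h3, dif_neg, not_false_eq_true, show k - 1 < k by omega, dif_pos, hlast]
  rw [this]
  simp [f]

lemma cnt_eq_iff {n k : ℕ} (T : Fin n → Fin k) (c : Fin k → ℕ) (hc : validC n c) :
    cnt T = c ↔ ∀ i, (Finset.univ.filter (fun j => T j = i)).card = c i - prv c i := by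
  constructor
  · rintro rfl i
    have := cnt_eq_prv T i
    omega
  · intro h
    have : ∀ t (ht : t < k), cnt T ⟨t, ht⟩ = c ⟨t, ht⟩ := by
      intro t
      induction t with
      | zero =>
        intro ht
        rw [cnt_eq_prv, h]
        simp [prv]
      | succ t ih =>
        intro ht
        have h1 := hc.1 ⟨t+1, ht⟩
        rw [cnt_eq_prv, h]
        have h2 := ih (by omega)
        simp only [prv, Nat.add_eq_zero_iff, one_ne_zero, and_false, dif_neg, not_false_eq_true,
          Nat.add_sub_cancel] at h1 ⊢
        rw [h2]
        omega
    funext t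
    exact this t t.2

def pcount {k : ℕ} (n : ℕ) (c : Fin k → ℕ) : ℕ :=
  (Finset.univ.filter (fun T : Fin n → Fin k => cnt T = c)).card

lemma pcount_valid {n k : ℕ} (hk : 0 < k) (c : Fin k → ℕ) (hc : validC n c) :
    pcount n c * ∏ i, (c i - prv c i).factorial = n.factorial := by
  rw [← fiber_count n (fun i => c i - prv c i) (sum_valid hk c hc)]
  unfold pcount
  simp_rw [cnt_eq_iff _ c hc]

lemma pcount_ne {n k : ℕ} (c : Fin k → ℕ) (h : pcount n c ≠ 0) : validC n c := by
  unfold pcount at h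
  rw [Finset.card_ne_zero] at h
  obtain ⟨T, hT⟩ := h
  simp only [Finset.mem_filter, Finset.mem_univ, true_and] at hT
  rw [← hT]
  exact cnt_valid T

lemma prv_inf {k : ℕ} (a b : Fin k → ℕ) (i) : prv (a ⊓ b) i = min (prv a i) (prv b i) := by
  unfold prv; split_ifs <;> simp

lemma prv_sup {k : ℕ} (a b : Fin k → ℕ) (i) : prv (a ⊔ b) i = max (prv a i) (prv b i) := by
  unfold prv; split_ifs <;> simp

lemma pcount_supermod {n k : ℕ} (hk : 0 < k) (a b : Fin k → ℕ) :
    pcount n a * pcount n b ≤ pcount n (a ⊓ b) * pcount n (a ⊔ b) := by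
  by_cases ha : pcount n a = 0
  · simp [ha]
  by_cases hb : pcount n b = 0
  · simp [hb]
  have va := pcount_ne a ha
  have vb := pcount_ne b hb
  have vi : validC n (a ⊓ b) := by
    refine ⟨fun i => ?_, fun i hi => ?_⟩
    · rw [prv_inf]; exact min_le_min (va.1 i) (vb.1 i)
    · simp [va.2 i hi, vb.2 i hi]
  have vs : validC n (a ⊔ b) := by
    refine ⟨fun i => ?_, fun i hi => ?_⟩
    · rw [prv_sup]; exact max_le_max (va.1 i) (vb.1 i)
    · simp [va.2 i hi, vb.2 i hi]
  have ea := pcount_valid hk a va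
  have eb := pcount_valid hk b vb
  have ei := pcount_valid hk _ vi
  have es := pcount_valid hk _ vs
  set A := ∏ i, (a i - prv a i).factorial
  set B := ∏ i, (b i - prv b i).factorial
  set I := ∏ i, ((a ⊓ b) i - prv (a ⊓ b) i).factorial
  set S := ∏ i, ((a ⊔ b) i - prv (a ⊔ b) i).factorial
  have hle : I * S ≤ A * B := by
    simp only [I, S, A, B, ← Finset.prod_mul_distrib]
    apply Finset.prod_le_prod'
    intro i _
    rw [prv_inf, prv_sup]
    exact fact_minmax _ _ _ _ (va.1 i) (vb.1 i)
  have hIS : 0 < I * S := Nat.mul_pos (Finset.prod_pos fun i _ => Nat.factorial_pos _)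
    (Finset.prod_pos fun i _ => Nat.factorial_pos _)
  have e1 : pcount n a * pcount n b * (A * B) = n.factorial * n.factorial := by
    rw [← ea]; nth_rewrite 2 [ea]; rw [← eb]; ring
  have e2 : pcount n (a ⊓ b) * pcount n (a ⊔ b) * (I * S) = n.factorial * n.factorial := by
    rw [← ei]; nth_rewrite 2 [ei]; rw [← es]; ring
  by_contra hlt
  push Not at hlt
  have : pcount n (a ⊓ b) * pcount n (a ⊔ b) * (I * S) < pcount n a * pcount n b * (A * B) :=
    calc _ < pcount n a * pcount n b * (I * S) := Nat.mul_lt_mul_of_pos_right hlt hIS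
      _ ≤ _ := Nat.mul_le_mul_left _ hle
  omega

lemma ind_nonneg (P : Prop) : 0 ≤ ind P := by unfold ind; split_ifs <;> norm_num
lemma ind_le_one (P : Prop) : ind P ≤ 1 := by unfold ind; split_ifs <;> norm_num
lemma ind_pos {P : Prop} (h : P) : ind P = 1 := by unfold ind; simp [h]
lemma ind_neg {P : Prop} (h : ¬ P) : ind P = 0 := by unfold ind; simp [h]
lemma ind_and (P Q : Prop) : ind (P ∧ Q) = ind P * ind Q := by
  unfold ind; split_ifs <;> simp_all
lemma ind_mono {P Q : Prop} (h : P → Q) : ind P ≤ ind Q := by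
  by_cases hP : P
  · rw [ind_pos hP, ind_pos (h hP)]
  · rw [ind_neg hP]; exact ind_nonneg _
lemma ind_not (P : Prop) : ind (¬ P) = 1 - ind P := by
  unfold ind; split_ifs <;> simp_all
lemma ind_congr {P Q : Prop} (h : P ↔ Q) : ind P = ind Q := by rw [propext h]

lemma SS_eq {n k : ℕ} (q : ℝ) (F : (Fin k → ℕ) → ℝ) :
    SS n k q F = ∑ c : Fin k → Fin (n+1), (pcount n (fun t => (c t : ℕ)) : ℝ)
      * q ^ (∑ t, (n - (c t : ℕ))) * F (fun t => (c t : ℕ)) := by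
  unfold SS
  let φ : (Fin n → Fin k) → (Fin k → Fin (n+1)) := fun T t =>
    ⟨cnt T t, Nat.lt_succ_of_le (cnt_le T t)⟩
  rw [← Finset.sum_fiberwise (s := Finset.univ) (g := φ)]
  apply Finset.sum_congr rfl
  intro c _
  have h1 : (Finset.univ.filter (fun T : Fin n → Fin k => φ T = c))
      = Finset.univ.filter (fun T : Fin n → Fin k => cnt T = fun t => (c t : ℕ)) := by
    ext T
    simp only [Finset.mem_filter, Finset.mem_univ, true_and, φ]
    constructor
    · rintro rfl; rfl
    · intro h; funext t; ext; simpa using congrFun h t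
  rw [h1]
  unfold pcount
  rw [Finset.sum_congr rfl (g := fun _ => q ^ (∑ t, (n - (c t : ℕ))) * F (fun t => (c t : ℕ)))]
  · simp [mul_assoc]
  · intro T hT
    simp only [Finset.mem_filter, Finset.mem_univ, true_and] at hT
    rw [sum_eq_cnt, hT]

lemma fkg_SS {n k : ℕ} (hk : 0 < k) (q : ℝ) (hq : 0 ≤ q) (A : (Fin k → ℕ) → Prop)
    (hA : ∀ a b, A a → A b → A (a ⊓ b) ∧ A (a ⊔ b)) (f g : (Fin k → ℕ) → ℝ)
    (hf0 : ∀ c, 0 ≤ f c) (hg0 : ∀ c, 0 ≤ g c) (hf : Monotone f) (hg : Monotone g) :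
    SS n k q (fun c => ind (A c) * f c) * SS n k q (fun c => ind (A c) * g c)
    ≤ SS n k q (fun c => ind (A c)) * SS n k q (fun c => ind (A c) * (f c * g c)) := by
  simp only [SS_eq]
  let v : (Fin k → Fin (n+1)) → (Fin k → ℕ) := fun c t => (c t : ℕ)
  have hv : Monotone v := fun a b h t => h t
  have hvi : ∀ a b, v (a ⊓ b) = v a ⊓ v b := by
    intro a b; funext t
    simp only [v, Pi.inf_apply]
    rcases le_total (a t) (b t) with h | h
    · rw [inf_eq_left.2 h, inf_eq_left.2 (by exact h)]
    · rw [inf_eq_right.2 h, inf_eq_right.2 (by exact h)]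
  have hvs : ∀ a b, v (a ⊔ b) = v a ⊔ v b := by
    intro a b; funext t
    simp only [v, Pi.sup_apply]
    rcases le_total (a t) (b t) with h | h
    · rw [sup_eq_right.2 h, sup_eq_right.2 (by exact h)]
    · rw [sup_eq_left.2 h, sup_eq_left.2 (by exact h)]
  let μ : (Fin k → Fin (n+1)) → ℝ := fun c =>
    (pcount n (v c) : ℝ) * q ^ (∑ t, (n - (v c t : ℕ))) * ind (A (v c))
  have := fkg (μ := μ) (f := fun c => f (v c)) (g := fun c => g (v c)) ?_ ?_ ?_ ?_ ?_ ?_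
  · simpa only [μ, mul_assoc] using this
  · intro c
    exact mul_nonneg (mul_nonneg (Nat.cast_nonneg _) (pow_nonneg hq _)) (ind_nonneg _)
  · intro c; exact hf0 _
  · intro c; exact hg0 _
  · exact hf.comp hv
  · exact hg.comp hv
  · intro a b
    simp only [μ]
    by_cases ha : A (v a)
    swap
    · rw [ind_neg ha]; simp only [mul_zero, zero_mul]
      exact mul_nonneg (mul_nonneg (mul_nonneg (Nat.cast_nonneg _) (pow_nonneg hq _)) (ind_nonneg _))
        (mul_nonneg (mul_nonneg (Nat.cast_nonneg _) (pow_nonneg hq _)) (ind_nonneg _))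
    by_cases hb : A (v b)
    swap
    · rw [ind_neg hb]; simp only [mul_zero]
      exact mul_nonneg (mul_nonneg (mul_nonneg (Nat.cast_nonneg _) (pow_nonneg hq _)) (ind_nonneg _))
        (mul_nonneg (mul_nonneg (Nat.cast_nonneg _) (pow_nonneg hq _)) (ind_nonneg _))
    rw [hvi, hvs, ind_pos ha, ind_pos hb, ind_pos (hA _ _ ha hb).1, ind_pos (hA _ _ ha hb).2]
    have h1 : (pcount n (v a) : ℝ) * pcount n (v b)
        ≤ pcount n (v a ⊓ v b) * pcount n (v a ⊔ v b) := by
      exact_mod_cast pcount_supermod hk (v a) (v b)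
    have h2 : (∑ t, (n - v a t)) + (∑ t, (n - v b t))
        = (∑ t, (n - (v a ⊓ v b) t)) + (∑ t, (n - (v a ⊔ v b) t)) := by
      rw [← Finset.sum_add_distrib, ← Finset.sum_add_distrib]
      apply Finset.sum_congr rfl
      intro t _
      simp only [Pi.inf_apply, Pi.sup_apply]
      rcases le_total (v a t) (v b t) with h | h
      · rw [inf_eq_left.2 h, sup_eq_right.2 h]
      · rw [inf_eq_right.2 h, sup_eq_left.2 h, add_comm]
    calc _ = ((pcount n (v a) : ℝ) * pcount n (v b)) *
          q ^ ((∑ t, (n - v a t)) + (∑ t, (n - v b t))) := by rw [pow_add]; ring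
      _ ≤ (pcount n (v a ⊓ v b) * pcount n (v a ⊔ v b)) *
          q ^ ((∑ t, (n - v a t)) + (∑ t, (n - v b t))) :=
          mul_le_mul_of_nonneg_right h1 (pow_nonneg hq _)
      _ = _ := by rw [h2, pow_add]; ring


lemma cnt_insertNth {n k : ℕ} (hk : 0 < k) (j : Fin (n+1)) (T : Fin n → Fin k) :
    cnt (Fin.insertNth (α := fun _ => Fin k) j (⟨0, hk⟩ : Fin k) T) = fun t => cnt T t + 1 := by
  funext t
  simp only [cnt, Finset.card_filter]
  rw [Fin.sum_univ_succAbove _ j]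
  simp only [Fin.insertNth_apply_same, Fin.insertNth_apply_succAbove]
  rw [if_pos (by rw [Fin.le_def]; exact Nat.zero_le _), add_comm]

lemma SS_step {n k : ℕ} (hk : 0 < k) (q : ℝ) (G : (Fin k → ℕ) → ℝ) :
    SS (n+1) k q (fun c => G c * (c ⟨0, hk⟩ : ℝ))
      = (n+1 : ℝ) * SS n k q (fun c => G (fun t => c t + 1)) := by
  have h0 : ∀ T : Fin (n+1) → Fin k, (cnt T ⟨0, hk⟩ : ℝ)
      = ∑ j, if T j = ⟨0, hk⟩ then (1:ℝ) else 0 := by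
    intro T
    unfold cnt
    rw [Finset.card_filter]
    push_cast
    apply Finset.sum_congr rfl
    intro j _
    have : T j ≤ ⟨0, hk⟩ ↔ T j = ⟨0, hk⟩ := by
      rw [Fin.le_def, Fin.ext_iff]; simp
    simp only [this]
  unfold SS
  simp_rw [h0, Finset.mul_sum]
  rw [Finset.sum_comm]
  have hj : ∀ j : Fin (n+1), (∑ T : Fin (n+1) → Fin k, q ^ (∑ i, (T i : ℕ)) *
      (G (cnt T) * if T j = ⟨0, hk⟩ then (1:ℝ) else 0))
      = ∑ T : Fin n → Fin k, q ^ (∑ i, (T i : ℕ)) * G (fun t => cnt T t + 1) := by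
    intro j
    rw [← (Fin.insertNthEquiv (fun _ : Fin (n+1) => Fin k) j).sum_comp, Fintype.sum_prod_type]
    rw [Finset.sum_eq_single (⟨0, hk⟩ : Fin k)]
    · apply Finset.sum_congr rfl
      intro T _
      have e : Fin.insertNthEquiv (fun _ : Fin (n+1) => Fin k) j (⟨0, hk⟩, T)
        = Fin.insertNth (α := fun _ => Fin k) j (⟨0, hk⟩ : Fin k) T := rfl
      rw [e]
      simp only [Fin.insertNth_apply_same, if_true, mul_one]
      rw [cnt_insertNth, Fin.sum_univ_succAbove _ j]
      simp
    · intro a _ ha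
      apply Finset.sum_eq_zero
      intro T _
      simp [ha]
    · simp
  rw [Finset.sum_congr rfl (fun j _ => hj j)]
  simp [Finset.mul_sum]

lemma SS_desc {k : ℕ} (hk : 0 < k) (q : ℝ) (n m : ℕ) : ∀ (G : (Fin k → ℕ) → ℝ),
    SS (n+m) k q (fun c => G c * ((c ⟨0, hk⟩).descFactorial m : ℝ))
      = ((n+m).descFactorial m : ℝ) * SS n k q (fun c => G (fun t => c t + m)) := by
  induction m with
  | zero => intro G; simp
  | succ m ih =>
    intro G
    have h1 : (fun c : Fin k → ℕ => G c * ((c ⟨0, hk⟩).descFactorial (m+1) : ℝ))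
        = fun c => (G c * ((c ⟨0, hk⟩ - 1).descFactorial m : ℝ)) * (c ⟨0, hk⟩ : ℝ) := by
      funext c
      rcases hc : c ⟨0, hk⟩ with _ | r
      · simp
      · rw [Nat.succ_descFactorial_succ]; rw [Nat.add_sub_cancel]; push_cast; ring
    rw [h1, ← add_assoc, SS_step hk q]
    simp only [Nat.add_sub_cancel]
    rw [ih (fun c => G (fun t => c t + 1)), Nat.succ_descFactorial_succ]
    push_cast
    rw [← mul_assoc]
    congr 2

lemma SS_trunc {n K k : ℕ} (hK : 0 < K) (hKk : K ≤ k) (q : ℝ) (H : (Fin k → ℕ) → ℝ) :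
    SS n k q (fun c => ind (n ≤ c ⟨K-1, by omega⟩) * H c)
      = ∑ T : Fin n → Fin K, q ^ (∑ j, (T j : ℕ)) *
        H (cnt (fun j => Fin.castLE hKk (T j))) := by
  unfold SS
  symm
  apply Fintype.sum_of_injective (fun (T : Fin n → Fin K) j => Fin.castLE hKk (T j))
  · intro T T' h
    funext j
    exact Fin.castLE_injective hKk (congrFun h j)
  · intro T hT
    have : ¬ (n ≤ cnt T ⟨K-1, by omega⟩) := by
      intro hn
      apply hT
      have hall : ∀ j, T j ≤ ⟨K-1, by omega⟩ := by
        have h1 : (Finset.univ.filter (fun j => T j ≤ ⟨K-1, by omega⟩)) = Finset.univ := by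
          apply Finset.eq_univ_of_card
          have := cnt_le T ⟨K-1, by omega⟩
          unfold cnt at this hn
          simp only [Fintype.card_fin]
          omega
        intro j
        have := Finset.mem_univ j
        rw [← h1] at this
        simpa using this
      refine ⟨fun j => ⟨T j, ?_⟩, ?_⟩
      · have := hall j; rw [Fin.le_def] at this; simp at this; omega
      · funext j; ext; simp
    beta_reduce
    rw [ind_neg this]; simp
  · intro T
    have : n ≤ cnt (fun j => Fin.castLE hKk (T j)) ⟨K-1, by omega⟩ := by
      unfold cnt
      rw [Finset.filter_true_of_mem]
      · simp
      · intro j _; rw [Fin.le_def]; simp; omega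
    beta_reduce
    rw [ind_pos this]; simp

noncomputable def Pr (k : ℕ) (p : ℝ) (E : (Fin (k-1) → Fin k) → Prop) : ℝ :=
  ∑ T, wt k p T * ind (E T)

lemma wt_eq (k : ℕ) (p : ℝ) (T : Fin (k-1) → Fin k) :
    wt k p T = (p / (1 - (1-p)^k))^(k-1) * (1-p)^(∑ j, (T j : ℕ)) := by
  unfold wt
  rw [Finset.prod_congr rfl (g := fun j => (p / (1 - (1-p)^k)) * (1-p)^(T j : ℕ))
    (by intro j _; ring)]
  rw [Finset.prod_mul_distrib, Finset.prod_pow_eq_pow_sum]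
  simp only [Finset.prod_const, Finset.card_univ, Fintype.card_fin]

/-- profile version of TREE -/
def TreeC {k : ℕ} (c : Fin k → ℕ) : Prop := ∀ t : Fin k, (t:ℕ) + 1 < k → (t:ℕ) + 1 ≤ c t

lemma filter_lt_card {n k : ℕ} (T : Fin n → Fin k) (t : ℕ) (ht : t < k) :
    (Finset.univ.filter (fun j => ((T j : ℕ) < t + 1))).card = cnt T ⟨t, ht⟩ := by
  unfold cnt
  congr 1
  ext j
  simp only [Finset.mem_filter, Finset.mem_univ, true_and, Fin.le_def]
  omega

lemma TREE_iff (k : ℕ) (T : Fin (k-1) → Fin k) : TREEevt k T ↔ TreeC (cnt T) := by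
  unfold TREEevt TreeC
  constructor
  · intro h t ht
    have := h ((t:ℕ)+1) (by omega) (by omega)
    rwa [filter_lt_card T t t.2] at this
  · intro h t h1 h2
    obtain ⟨s, rfl⟩ : ∃ s, t = s + 1 := ⟨t-1, by omega⟩
    rw [filter_lt_card T s (by omega)]
    exact h ⟨s, by omega⟩ (by simp; omega)

/-- profile version of `M`, `n` balls -/
noncomputable def MC (k n : ℕ) (c : Fin k → ℕ) : ℝ :=
  (Nat.choose k 2 : ℝ) - n - ((n : ℝ) * k - ∑ t, (c t : ℝ))

lemma sum_eq_cnt' {n k : ℕ} (T : Fin n → Fin k) :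
    ∑ t, (cnt T t : ℝ) = (n : ℝ) * k - ∑ j, (T j : ℝ) := by
  have h := sum_eq_cnt T
  have h2 : ((∑ j, (T j : ℕ) : ℕ) : ℝ) = ((∑ t, (n - cnt T t) : ℕ) : ℝ) := by rw [h]
  push_cast at h2
  rw [h2]
  have : ∀ t, ((n - cnt T t : ℕ) : ℝ) = (n : ℝ) - cnt T t := by
    intro t; rw [Nat.cast_sub (cnt_le T t)]
  simp_rw [this]
  rw [Finset.sum_sub_distrib]
  simp
  ring

lemma Mval_eq (k : ℕ) (T : Fin (k-1) → Fin k) :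
    (Mval k T : ℝ) = (Nat.choose k 2 : ℝ) - ((k-1 : ℕ) : ℝ) - ∑ j, (T j : ℝ) := by
  unfold Mval
  push_cast
  rw [Finset.sum_add_distrib]
  simp
  ring

lemma Mval_MC (k : ℕ) (T : Fin (k-1) → Fin k) : (Mval k T : ℝ) = MC k (k-1) (cnt T) := by
  rw [Mval_eq, MC, sum_eq_cnt']
  ring

lemma MC_mono (k n : ℕ) : Monotone (MC k n) := by
  intro a b h
  unfold MC
  have : ∑ t, (a t : ℝ) ≤ ∑ t, (b t : ℝ) := Finset.sum_le_sum fun t _ => by exact_mod_cast h t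
  linarith

lemma Pr_SS (k : ℕ) (p : ℝ) (E : (Fin (k-1) → Fin k) → Prop) (F : (Fin k → ℕ) → ℝ)
    (h : ∀ T, ind (E T) = F (cnt T)) :
    Pr k p E = (p / (1 - (1-p)^k))^(k-1) * SS (k-1) k (1-p) F := by
  unfold Pr SS
  rw [Finset.mul_sum]
  apply Finset.sum_congr rfl
  intro T _
  rw [wt_eq, h]; ring

lemma denom_pos {p : ℝ} {k : ℕ} (hp : 0 < p) (hp1 : p ≤ 1) (hk : 0 < k) : 0 < 1 - (1-p)^k := by
  have : (1-p)^k < 1 := pow_lt_one₀ (by linarith) (by linarith) (by omega)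
  linarith

lemma fact_pos {p : ℝ} {k : ℕ} (hp : 0 < p) (hp1 : p ≤ 1) (hk : 0 < k) :
    0 < (p / (1 - (1-p)^k))^(k-1) := pow_pos (div_pos hp (denom_pos hp hp1 hk)) _

lemma treeProb_Pr (k : ℕ) (p : ℝ) : treeProb k p = Pr k p (TREEevt k) := rfl

lemma fkg_lower {k : ℕ} {p : ℝ} (hp : 0 < p) (hp1 : p ≤ 1) (hk : 0 < k) (x : ℝ) :
    treeProb k p * Pr k p (fun T => x < (Mval k T : ℝ))
      ≤ Pr k p (fun _ => True) * Pr k p (fun T => TREEevt k T ∧ x < (Mval k T : ℝ)) := by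
  rw [treeProb_Pr]
  rw [Pr_SS k p (TREEevt k) (fun c => ind ((fun _ => True) c) * ind (TreeC c))
      (by intro T; rw [ind_congr (TREE_iff k T), ind_pos trivial, one_mul]),
    Pr_SS k p _ (fun c => ind ((fun _ => True) c) * ind (x < MC k (k-1) c))
      (by intro T; rw [Mval_MC, ind_pos trivial, one_mul]),
    Pr_SS k p (fun _ => True) (fun c => ind ((fun _ => True) c)) (by intro T; rfl),
    Pr_SS k p _ (fun c => ind ((fun _ => True) c) * (ind (TreeC c) * ind (x < MC k (k-1) c)))
      (by intro T; rw [ind_and, Mval_MC, ind_pos trivial, one_mul, ind_congr (TREE_iff k T)])]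
  have h := fkg_SS (n := k-1) hk (1-p) (by linarith) (fun _ => True) (fun _ _ _ _ => ⟨trivial, trivial⟩)
    (fun c => ind (TreeC c)) (fun c => ind (x < MC k (k-1) c)) (fun _ => ind_nonneg _)
    (fun _ => ind_nonneg _)
    (fun a b hab => ind_mono fun h t ht => (h t ht).trans (hab t))
    (fun a b hab => ind_mono fun h => h.trans_le (MC_mono k (k-1) hab))
  have hF := fact_pos hp hp1 hk
  set C := (p / (1 - (1-p)^k))^(k-1)
  calc _ = C * C * _ := by ring
    _ ≤ C * C * _ := mul_le_mul_of_nonneg_left h (by positivity)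
    _ = _ := by ring

/-- the event that the path of the smaller model stays above `-m` -/
def GoodEvt (K m : ℕ) (T : Fin (K-1) → Fin K) : Prop :=
  ∀ t, t ≤ K - 1 → t ≤ (Finset.univ.filter (fun j => ((T j : ℕ) < t))).card + m

lemma fkg_upper {K m : ℕ} {p : ℝ} (hp : 0 < p) (hp1 : p ≤ 1) (hK : 0 < K) (x : ℝ) :
    Pr (K+m) p (fun T => TREEevt (K+m) T ∧ x < (Mval (K+m) T : ℝ)) * Pr K p (GoodEvt K m)
      ≤ treeProb (K+m) p * Pr K p (fun T => x - ((Nat.choose (K+m) 2 : ℝ) - ((K+m-1 : ℕ):ℝ)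
        - (Nat.choose K 2 : ℝ) + ((K-1 : ℕ) : ℝ)) < (Mval K T : ℝ)) := by
  have hk : 0 < K + m := by omega
  have hn : K + m - 1 = (K - 1) + m := by omega
  have hKk : K ≤ K + m := by omega
  rw [treeProb_Pr]
  rw [Pr_SS (K+m) p (TREEevt (K+m)) (fun c => ind (TreeC c))
      (by intro T; rw [ind_congr (TREE_iff (K+m) T)]),
    Pr_SS (K+m) p _ (fun c => ind (TreeC c) * ind (x < MC (K+m) (K+m-1) c))
      (by intro T; rw [ind_and, Mval_MC, ind_congr (TREE_iff (K+m) T)])]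
  have h := fkg_SS (n := K+m-1) hk (1-p) (by linarith) TreeC
    (fun a b ha hb => ⟨fun t ht => le_inf (ha t ht) (hb t ht), fun t ht => (ha t ht).trans le_sup_left⟩)
    (fun c => ind (x < MC (K+m) (K+m-1) c))
    (fun c => ind (K+m-1 ≤ c ⟨K-1, by omega⟩) * ((c ⟨0, hk⟩).descFactorial m : ℝ))
    (fun _ => ind_nonneg _) (fun c => mul_nonneg (ind_nonneg _) (Nat.cast_nonneg _))
    (fun a b hab => ind_mono fun h => h.trans_le (MC_mono _ _ hab))
    (fun a b hab => mul_le_mul (ind_mono fun h => h.trans (hab _))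
      (by exact_mod_cast Nat.descFactorial_le _ (hab _)) (Nat.cast_nonneg _) (ind_nonneg _))
  -- rewrite the two sums containing the descending factorial
  have r1 : SS (K+m-1) (K+m) (1-p) (fun c => ind (TreeC c) *
      (ind (K+m-1 ≤ c ⟨K-1, by omega⟩) * ((c ⟨0, hk⟩).descFactorial m : ℝ)))
      = ((K+m-1).descFactorial m : ℝ) * ∑ T : Fin (K-1) → Fin K, (1-p) ^ (∑ j, (T j : ℕ)) *
        ind (TreeC (fun t => cnt (fun j => Fin.castLE hKk (T j)) t + m)) := by
    simp_rw [← mul_assoc]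
    rw [hn, SS_desc hk (1-p) (K-1) m
      (fun c => ind (TreeC c) * ind (K-1+m ≤ c ⟨K-1, by omega⟩))]
    congr 1
    rw [← SS_trunc hK hKk (1-p) (fun c => ind (TreeC (fun t => c t + m)))]
    congr 1
    funext c
    rw [mul_comm]
    congr 1
    apply ind_congr
    beta_reduce
    omega
  have r2 : SS (K+m-1) (K+m) (1-p) (fun c => ind (TreeC c) * (ind (x < MC (K+m) (K+m-1) c) *
      (ind (K+m-1 ≤ c ⟨K-1, by omega⟩) * ((c ⟨0, hk⟩).descFactorial m : ℝ))))
      = ((K+m-1).descFactorial m : ℝ) * ∑ T : Fin (K-1) → Fin K, (1-p) ^ (∑ j, (T j : ℕ)) *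
        (ind (TreeC (fun t => cnt (fun j => Fin.castLE hKk (T j)) t + m)) *
        ind (x < MC (K+m) (K+m-1) (fun t => cnt (fun j => Fin.castLE hKk (T j)) t + m))) := by
    simp_rw [← mul_assoc]
    rw [hn, SS_desc hk (1-p) (K-1) m
      (fun c => ind (TreeC c) * ind (x < MC (K+m) (K-1+m) c)
        * ind (K-1+m ≤ c ⟨K-1, by omega⟩))]
    congr 1
    simp_rw [mul_assoc]
    rw [← SS_trunc hK hKk (1-p) (fun c => ind (TreeC (fun t => c t + m)) *
      ind (x < MC (K+m) (K-1+m) (fun t => c t + m)))]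
    congr 1
    funext c
    rw [← mul_assoc, mul_comm]
    congr 1
    apply ind_congr
    beta_reduce
    omega
  rw [r1, r2] at h
  have hD : (0:ℝ) < ((K+m-1).descFactorial m : ℝ) := by
    exact_mod_cast Nat.descFactorial_pos.2 (by omega)
  set D := ((K+m-1).descFactorial m : ℝ)
  have q0 : 0 ≤ 1 - p := by linarith
  -- the sums in the small model
  have g1 : ∑ T : Fin (K-1) → Fin K, (1-p) ^ (∑ j, (T j : ℕ)) * ind (GoodEvt K m T)
      ≤ ∑ T : Fin (K-1) → Fin K, (1-p) ^ (∑ j, (T j : ℕ)) *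
        ind (TreeC (fun t => cnt (fun j => Fin.castLE hKk (T j)) t + m)) := by
    apply Finset.sum_le_sum
    intro T _
    apply mul_le_mul_of_nonneg_left _ (pow_nonneg q0 _)
    apply ind_mono
    intro hG t ht
    show (t:ℕ) + 1 ≤ cnt (fun j => Fin.castLE hKk (T j)) t + m
    rw [← filter_lt_card (fun j => Fin.castLE hKk (T j)) (t:ℕ) t.2]
    simp only [Fin.val_castLE]
    by_cases htK : (t:ℕ) + 1 ≤ K - 1
    · exact hG _ htK
    · rw [Finset.filter_true_of_mem]
      · simp; omega
      · intro j _; have := (T j).2; omega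
  have g2 : ∑ T : Fin (K-1) → Fin K, (1-p) ^ (∑ j, (T j : ℕ)) *
        (ind (TreeC (fun t => cnt (fun j => Fin.castLE hKk (T j)) t + m)) *
        ind (x < MC (K+m) (K+m-1) (fun t => cnt (fun j => Fin.castLE hKk (T j)) t + m)))
      ≤ ∑ T : Fin (K-1) → Fin K, (1-p) ^ (∑ j, (T j : ℕ)) *
        ind (x - ((Nat.choose (K+m) 2 : ℝ) - ((K+m-1 : ℕ):ℝ)
        - (Nat.choose K 2 : ℝ) + ((K-1 : ℕ) : ℝ)) < (Mval K T : ℝ)) := by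
    apply Finset.sum_le_sum
    intro T _
    apply mul_le_mul_of_nonneg_left _ (pow_nonneg q0 _)
    refine le_trans (mul_le_of_le_one_left (ind_nonneg _) (ind_le_one _)) (ind_mono ?_)
    intro hx
    have e : MC (K+m) (K+m-1) (fun t => cnt (fun j => Fin.castLE hKk (T j)) t + m)
        = (Nat.choose (K+m) 2 : ℝ) - ((K+m-1 : ℕ):ℝ) - ∑ j, (T j : ℝ) := by
      unfold MC
      push_cast
      rw [Finset.sum_add_distrib, sum_eq_cnt']
      simp only [Fin.val_castLE, Finset.sum_const, Finset.card_univ, Fintype.card_fin, nsmul_eq_mul]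
      have : ((K+m-1 : ℕ) : ℝ) = ((K-1 : ℕ) : ℝ) + m := by rw [hn]; push_cast; ring
      rw [this]
      push_cast
      ring
    rw [e] at hx
    rw [Mval_eq]
    linarith
  have e3 : Pr K p (GoodEvt K m) = (p / (1 - (1-p)^K))^(K-1) *
      ∑ T : Fin (K-1) → Fin K, (1-p) ^ (∑ j, (T j : ℕ)) * ind (GoodEvt K m T) := by
    unfold Pr; rw [Finset.mul_sum]; simp_rw [wt_eq, mul_assoc]
  have e4 : Pr K p (fun T => x - ((Nat.choose (K+m) 2 : ℝ) - ((K+m-1 : ℕ):ℝ)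
        - (Nat.choose K 2 : ℝ) + ((K-1 : ℕ) : ℝ)) < (Mval K T : ℝ)) = (p / (1 - (1-p)^K))^(K-1) *
      ∑ T : Fin (K-1) → Fin K, (1-p) ^ (∑ j, (T j : ℕ)) *
        ind (x - ((Nat.choose (K+m) 2 : ℝ) - ((K+m-1 : ℕ):ℝ)
        - (Nat.choose K 2 : ℝ) + ((K-1 : ℕ) : ℝ)) < (Mval K T : ℝ)) := by
    unfold Pr; rw [Finset.mul_sum]; simp_rw [wt_eq, mul_assoc]
  rw [e3, e4]
  have hF := fact_pos hp hp1 hk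
  have hF' := fact_pos hp hp1 hK
  set C := (p / (1 - (1-p)^(K+m)))^(K+m-1)
  set C' := (p / (1 - (1-p)^K))^(K-1)
  have s1 : 0 ≤ SS (K+m-1) (K+m) (1-p) (fun c => ind (TreeC c) * ind (x < MC (K+m) (K+m-1) c)) :=
    Finset.sum_nonneg fun T _ => mul_nonneg (pow_nonneg q0 _) (mul_nonneg (ind_nonneg _) (ind_nonneg _))
  have s2 : 0 ≤ SS (K+m-1) (K+m) (1-p) (fun c => ind (TreeC c)) :=
    Finset.sum_nonneg fun T _ => mul_nonneg (pow_nonneg q0 _) (ind_nonneg _)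
  set X1 := SS (K+m-1) (K+m) (1-p) (fun c => ind (TreeC c) * ind (x < MC (K+m) (K+m-1) c))
  set X2 := SS (K+m-1) (K+m) (1-p) (fun c => ind (TreeC c))
  set Y1 := ∑ T : Fin (K-1) → Fin K, (1-p) ^ (∑ j, (T j : ℕ)) *
        ind (TreeC (fun t => cnt (fun j => Fin.castLE hKk (T j)) t + m))
  set Y2 := ∑ T : Fin (K-1) → Fin K, (1-p) ^ (∑ j, (T j : ℕ)) *
        (ind (TreeC (fun t => cnt (fun j => Fin.castLE hKk (T j)) t + m)) *
        ind (x < MC (K+m) (K+m-1) (fun t => cnt (fun j => Fin.castLE hKk (T j)) t + m)))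
  have h' : X1 * Y1 ≤ X2 * Y2 := by
    have : D * (X1 * Y1) ≤ D * (X2 * Y2) := by linarith
    exact le_of_mul_le_mul_left this hD
  set Y0 := ∑ T : Fin (K-1) → Fin K, (1-p) ^ (∑ j, (T j : ℕ)) * ind (GoodEvt K m T)
  set Y3 := ∑ T : Fin (K-1) → Fin K, (1-p) ^ (∑ j, (T j : ℕ)) *
        ind (x - ((Nat.choose (K+m) 2 : ℝ) - ((K+m-1 : ℕ):ℝ)
        - (Nat.choose K 2 : ℝ) + ((K-1 : ℕ) : ℝ)) < (Mval K T : ℝ))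
  have hCC : 0 ≤ C * C' := by positivity
  calc C * X1 * (C' * Y0) = C * C' * (X1 * Y0) := by ring
    _ ≤ C * C' * (X1 * Y1) := mul_le_mul_of_nonneg_left (mul_le_mul_of_nonneg_left g1 s1) hCC
    _ ≤ C * C' * (X2 * Y2) := mul_le_mul_of_nonneg_left h' hCC
    _ ≤ C * C' * (X2 * Y3) := mul_le_mul_of_nonneg_left (mul_le_mul_of_nonneg_left g2 s2) hCC
    _ = C * X2 * (C' * Y3) := by ring


section IID
variable {α : Type} [Fintype α] {n : ℕ}

/-- expectation of `F` under the `n`-fold product of `w` -/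
noncomputable def EE (w : α → ℝ) (F : (Fin n → α) → ℝ) : ℝ := ∑ T, (∏ j, w (T j)) * F T

lemma EE_prod (w : α → ℝ) (f : Fin n → α → ℝ) :
    EE w (fun T => ∏ j, f j (T j)) = ∏ j, ∑ a, w a * f j a := by
  rw [Finset.prod_univ_sum, Fintype.piFinset_univ]
  unfold EE
  simp_rw [Finset.prod_mul_distrib]

lemma EE_add (w : α → ℝ) (F G : (Fin n → α) → ℝ) :
    EE w (fun T => F T + G T) = EE w F + EE w G := by
  unfold EE; simp_rw [mul_add]; rw [Finset.sum_add_distrib]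

lemma EE_sub (w : α → ℝ) (F G : (Fin n → α) → ℝ) :
    EE w (fun T => F T - G T) = EE w F - EE w G := by
  unfold EE; simp_rw [mul_sub]; rw [Finset.sum_sub_distrib]

lemma EE_mul (w : α → ℝ) (c : ℝ) (F : (Fin n → α) → ℝ) :
    EE w (fun T => c * F T) = c * EE w F := by
  unfold EE; rw [Finset.mul_sum]; apply Finset.sum_congr rfl; intros; ring

lemma EE_sum {ι : Type} (s : Finset ι) (w : α → ℝ) (F : ι → (Fin n → α) → ℝ) :
    EE w (fun T => ∑ i ∈ s, F i T) = ∑ i ∈ s, EE w (F i) := by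
  unfold EE; simp_rw [Finset.mul_sum]; rw [Finset.sum_comm]

lemma EE_mono {w : α → ℝ} (hw : ∀ a, 0 ≤ w a) {F G : (Fin n → α) → ℝ} (h : ∀ T, F T ≤ G T) :
    EE w F ≤ EE w G :=
  Finset.sum_le_sum fun T _ => mul_le_mul_of_nonneg_left (h T) (Finset.prod_nonneg fun _ _ => hw _)

lemma EE_const {w : α → ℝ} (h1 : ∑ a, w a = 1) (c : ℝ) :
    EE w (fun _ : Fin n → α => c) = c := by
  have := EE_prod (n := n) w (fun _ _ => 1)
  simp [h1] at this
  have h := EE_mul w c (fun _ : Fin n → α => (1:ℝ))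
  rw [this, mul_one] at h
  simpa using h

lemma EE_resample {w : α → ℝ} (h1 : ∑ a, w a = 1) (j : Fin n) (F : (Fin n → α) → ℝ) :
    EE w F = EE w (fun T => ∑ a, w a * F (Function.update T j a)) := by
  unfold EE
  have e : ∑ x : (Fin n → α) × α, (∏ i, w (x.1 i)) * (w x.2 * F (Function.update x.1 j x.2))
      = ∑ x : (Fin n → α) × α, (∏ i, w (x.1 i)) * (w x.2 * F x.1) := by
    let σ : ((Fin n → α) × α) → ((Fin n → α) × α) := fun x => (Function.update x.1 j x.2, x.1 j)
    have hσ : Function.Involutive σ := by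
      intro x
      simp [σ]
    rw [← Equiv.sum_comp (Function.Involutive.toPerm σ hσ)]
    apply Finset.sum_congr rfl
    intro x _
    show (∏ i, w ((Function.update x.1 j x.2) i)) * (w (x.1 j) * F (Function.update
      (Function.update x.1 j x.2) j (x.1 j))) = _
    have hp : (∏ i, w ((Function.update x.1 j x.2) i)) * w (x.1 j) = (∏ i, w (x.1 i)) * w x.2 := by
      rw [← Finset.mul_prod_erase _ _ (Finset.mem_univ j),
        ← Finset.mul_prod_erase _ (fun i => w (x.1 i)) (Finset.mem_univ j)]
      rw [Finset.prod_congr rfl (g := fun i => w (x.1 i))]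
      · simp; ring
      · intro i hi
        rw [Function.update_of_ne (Finset.ne_of_mem_erase hi)]
    simp only [Function.update_idem, Function.update_eq_self]
    rw [← mul_assoc, hp]
    ring
  rw [Fintype.sum_prod_type, Fintype.sum_prod_type] at e
  simp_rw [Finset.mul_sum]
  rw [e]
  apply Finset.sum_congr rfl
  intro T _
  simp only []
  rw [← Finset.mul_sum, ← Finset.sum_mul, h1, one_mul]

lemma EE_single {w : α → ℝ} (h1 : ∑ a, w a = 1) (j : Fin n) (f : α → ℝ) :
    EE w (fun T => f (T j)) = ∑ a, w a * f a := by
  rw [EE_resample h1 j]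
  simp only [Function.update_self]
  rw [EE_const h1]

lemma EE_orth {w : α → ℝ} (h1 : ∑ a, w a = 1) (j : Fin n) (B : α → Prop) (ψ : α → ℝ)
    (hψ : ∀ a, B a → ψ a = 0) (hm : ∑ a, w a * ψ a = 0) (H : (Fin n → α) → ℝ)
    (hH : ∀ T a, ¬ B (T j) → ¬ B a → H (Function.update T j a) = H T) :
    EE w (fun T => ψ (T j) * H T) = 0 := by
  rw [EE_resample h1 j]
  have : ∀ T : Fin n → α, ∑ a, w a * (ψ (Function.update T j a j) * H (Function.update T j a)) = 0 := by
    intro T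
    simp only [Function.update_self]
    by_cases hB : ∃ a0, ¬ B a0
    · obtain ⟨a0, h0⟩ := hB
      rw [Finset.sum_congr rfl (g := fun a => (w a * ψ a) * H (Function.update T j a0)),
        ← Finset.sum_mul, hm, zero_mul]
      intro a _
      by_cases ha : B a
      · rw [hψ a ha]; ring
      · have := hH (Function.update T j a) a0 (by simpa using ha) h0
        rw [Function.update_idem] at this
        rw [this]; ring
    · push Not at hB
      apply Finset.sum_eq_zero
      intro a _
      rw [hψ a (hB a)]; ring
  simp_rw [this]
  exact EE_const h1 0

lemma EE_sq_sum {w : α → ℝ} (h1 : ∑ a, w a = 1) (ψ : α → ℝ) (hm : ∑ a, w a * ψ a = 0) :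
    EE w (fun T : Fin n → α => (∑ j, ψ (T j))^2) = n * ∑ a, w a * ψ a ^ 2 := by
  simp_rw [sq, Finset.sum_mul_sum]
  rw [EE_sum]
  have : ∀ i : Fin n, EE w (fun T : Fin n → α => ∑ j, ψ (T i) * ψ (T j)) = ∑ a, w a * (ψ a * ψ a) := by
    intro i
    rw [EE_sum, Finset.sum_eq_single i]
    · exact EE_single h1 i (fun a => ψ a * ψ a)
    · intro j _ hj
      apply EE_orth h1 i (fun _ => False) ψ (fun _ h => h.elim) hm (fun T => ψ (T j))
      intro T a _ _
      rw [Function.update_of_ne hj]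
    · simp
  simp_rw [this]
  simp


/-- mass of the set `B t` -/
noncomputable def FF (w : α → ℝ) (B : ℕ → α → Prop) (t : ℕ) : ℝ := ∑ a, w a * ind (B t a)
/-- number of balls in the set `B t` -/
noncomputable def NN (B : ℕ → α → Prop) (t : ℕ) (T : Fin n → α) : ℝ := ∑ j, ind (B t (T j))

/-- not hit through time `s` -/
def CC (w : α → ℝ) (B : ℕ → α → Prop) (m κ : ℝ) (s : ℕ) (T : Fin n → α) : Prop :=
  ∀ t ≤ s, |NN B t T - n * FF w B t| < m + κ * (n * FF w B t)

/-- single-ball martingale -/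
noncomputable def xi (w : α → ℝ) (B : ℕ → α → Prop) (t : ℕ) (a : α) : ℝ :=
  1 - ind (¬ B t a) / (1 - FF w B t)

lemma ind_sq (P : Prop) : ind P * ind P = ind P := by unfold ind; split_ifs <;> simp

lemma FF_compl {w : α → ℝ} (h1 : ∑ a, w a = 1) (B : ℕ → α → Prop) (t : ℕ) :
    ∑ a, w a * ind (¬ B t a) = 1 - FF w B t := by
  unfold FF
  rw [← h1, ← Finset.sum_sub_distrib]
  apply Finset.sum_congr rfl
  intro a _
  rw [ind_not]; ring

lemma xi_sum {w : α → ℝ} (B : ℕ → α → Prop) (t : ℕ)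
    (hF : FF w B t < 1) (T : Fin n → α) :
    ∑ j, xi w B t (T j) = (NN B t T - n * FF w B t) / (1 - FF w B t) := by
  have h : 1 - FF w B t ≠ 0 := by linarith
  unfold xi NN
  simp_rw [ind_not]
  rw [Finset.sum_sub_distrib, ← Finset.sum_div, Finset.sum_sub_distrib]
  simp
  field_simp
  ring

lemma hajek_renyi {w : α → ℝ} (hw : ∀ a, 0 ≤ w a) (h1 : ∑ a, w a = 1) (B : ℕ → α → Prop)
    (hB0 : ∀ a, ¬ B 0 a) (hB : ∀ t a, B t a → B (t+1) a) (m κ : ℝ) (hm : 0 < m) (hκ : 0 < κ)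
    (s : ℕ) (hF : ∀ t ≤ s, FF w B t < 1) :
    EE w (fun T : Fin n → α => ind (¬ CC w B m κ s T))
      + ((1 - FF w B s) / (m + κ * (n * FF w B s)))^2 *
        EE w (fun T : Fin n → α => (∑ j, xi w B s (T j))^2 * ind (CC w B m κ s T))
      ≤ (1/κ) * (1 / m - 1 / (m + κ * (n * FF w B s))) := by
  induction s with
  | zero =>
    have hF0 : FF w B 0 = 0 := by
      unfold FF; apply Finset.sum_eq_zero; intro a _; rw [ind_neg (hB0 a)]; ring
    have hC : ∀ T : Fin n → α, CC w B m κ 0 T := by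
      intro T t ht
      obtain rfl : t = 0 := by omega
      rw [hF0]
      have : NN B 0 T = 0 := by
        unfold NN; apply Finset.sum_eq_zero; intro j _; rw [ind_neg (hB0 _)]
      rw [this]; simpa using hm
    have hx : ∀ a, xi w B 0 a = 0 := by
      intro a; unfold xi; rw [hF0, ind_pos (hB0 a)]; simp
    have e1 : EE w (fun T : Fin n → α => ind (¬ CC w B m κ 0 T)) = 0 := by
      rw [show (fun T : Fin n → α => ind (¬ CC w B m κ 0 T)) = fun _ => 0 from
        funext fun T => ind_neg (not_not.2 (hC T)), EE_const h1]
    have e2 : EE w (fun T : Fin n → α => (∑ j, xi w B 0 (T j))^2 * ind (CC w B m κ 0 T)) = 0 := by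
      simp_rw [hx]
      simpa using EE_const h1 0
    rw [e1, e2, hF0]; simp
  | succ s ih =>
    have ih := ih (fun t ht => hF t (by omega))
    have f0 := hF s (by omega)
    have f1 := hF (s+1) le_rfl
    have fnn : 0 ≤ FF w B s := Finset.sum_nonneg fun a _ => mul_nonneg (hw a) (ind_nonneg _)
    have fm : FF w B s ≤ FF w B (s+1) := Finset.sum_le_sum fun a _ =>
      mul_le_mul_of_nonneg_left (ind_mono (hB s a)) (hw a)
    have c0 := FF_compl h1 B s
    have c1 := FF_compl h1 B (s+1)
    set f := FF w B s with hf
    set f' := FF w B (s+1) with hf'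
    set ψ : α → ℝ := fun a => xi w B (s+1) a - xi w B s a with hψ
    have hψe : ∀ a, ψ a = ind (¬ B s a) / (1 - f) - ind (¬ B (s+1) a) / (1 - f') := by
      intro a; simp only [hψ, xi]; rw [← hf, ← hf']; ring
    have g0 : 1 - f ≠ 0 := by linarith
    have g1 : 1 - f' ≠ 0 := by linarith
    have ψm : ∑ a, w a * ψ a = 0 := by
      have : ∀ a, w a * ψ a = (w a * ind (¬ B s a)) / (1 - f) - (w a * ind (¬ B (s+1) a)) / (1 - f') := by
        intro a; rw [hψe]; ring
      simp_rw [this]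
      rw [Finset.sum_sub_distrib, ← Finset.sum_div, ← Finset.sum_div, c0, c1, div_self g0, div_self g1,
        sub_self]
    have ψv : ∑ a, w a * ψ a ^ 2 = 1/(1-f') - 1/(1-f) := by
      have : ∀ a, w a * ψ a ^ 2 = (w a * ind (¬ B s a)) / (1 - f)^2
          + (w a * ind (¬ B (s+1) a)) * (1/(1 - f')^2 - 2/((1-f)*(1-f'))) := by
        intro a; rw [hψe]
        have p1 : ind (¬ B (s+1) a) * ind (¬ B s a) = ind (¬ B (s+1) a) := by
          rw [← ind_and]
          exact ind_congr ⟨fun h => h.1, fun h => ⟨h, fun h' => h (hB s a h')⟩⟩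
        have p2 := ind_sq (¬ B s a)
        have p3 := ind_sq (¬ B (s+1) a)
        generalize ind (¬ B s a) = x at *
        generalize ind (¬ B (s+1) a) = y at *
        calc w a * (x / (1-f) - y/(1-f'))^2 = w a * ((x*x)/(1-f)^2 + (y*y)/(1-f')^2
              - 2 * (y*x)/((1-f)*(1-f'))) := by field_simp; ring
          _ = _ := by rw [p1, p2, p3]; ring
      simp_rw [this]
      rw [Finset.sum_add_distrib, ← Finset.sum_div, ← Finset.sum_mul, c0, c1]
      field_simp
      ring
    set X : (Fin n → α) → ℝ := fun T => ∑ j, xi w B s (T j) with hX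
    set X' : (Fin n → α) → ℝ := fun T => ∑ j, xi w B (s+1) (T j) with hX'
    have hXX : ∀ T, X' T = X T + ∑ j, ψ (T j) := by
      intro T; simp only [hX, hX', hψ]; rw [← Finset.sum_add_distrib]
      apply Finset.sum_congr rfl; intros; ring
    have Bmono : ∀ t ≤ s, ∀ a, B t a → B s a := by
      intro t ht a h
      have : ∀ d, B (t+d) a := by
        intro d
        induction d with
        | zero => exact h
        | succ d ih2 => exact hB _ _ ih2
      have h5 := this (s-t)
      rwa [Nat.add_sub_cancel' ht] at h5
    have cross : EE w (fun T => ind (CC w B m κ s T) * X T * ∑ j, ψ (T j)) = 0 := by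
      simp_rw [Finset.mul_sum]
      rw [EE_sum]
      apply Finset.sum_eq_zero
      intro j _
      simp_rw [mul_comm _ (ψ _)]
      apply EE_orth h1 j (B s) ψ _ ψm
      · intro T a hT ha
        have hn : ∀ t ≤ s, NN B t (Function.update T j a) = NN B t T := by
          intro t ht
          unfold NN
          apply Finset.sum_congr rfl
          intro i _
          by_cases hij : i = j
          · subst hij
            simp only [Function.update_self]
            rw [ind_neg (fun h => ha (Bmono t ht a h)), ind_neg (fun h => hT (Bmono t ht _ h))]
          · rw [Function.update_of_ne hij]
        congr 1
        · apply ind_congr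
          unfold CC
          constructor
          · intro h t ht; rw [← hn t ht]; exact h t ht
          · intro h t ht; rw [hn t ht]; exact h t ht
        · simp only [hX]
          rw [xi_sum B s f0, xi_sum B s f0, hn s le_rfl]
      · intro a ha
        rw [hψe, ind_neg (not_not.2 ha), ind_neg (not_not.2 (hB s a ha))]; simp
    have key : EE w (fun T => X' T ^ 2 * ind (CC w B m κ s T))
        ≤ EE w (fun T => X T ^ 2 * ind (CC w B m κ s T)) + n * (1/(1-f') - 1/(1-f)) := by
      rw [← ψv, ← EE_sq_sum (n := n) h1 ψ ψm]
      have : ∀ T, X' T ^ 2 * ind (CC w B m κ s T) ≤ (X T ^ 2 * ind (CC w B m κ s T)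
          + (∑ j, ψ (T j))^2) + 2 * (ind (CC w B m κ s T) * X T * ∑ j, ψ (T j)) := by
        intro T
        rw [hXX]
        have a1 := ind_le_one (CC w B m κ s T)
        have a2 : (∑ j, ψ (T j))^2 * ind (CC w B m κ s T) ≤ (∑ j, ψ (T j))^2 :=
          mul_le_of_le_one_right (sq_nonneg _) a1
        nlinarith [a2]
      refine (EE_mono hw this).trans (le_of_eq ?_)
      rw [EE_add, EE_add, EE_mul, cross]; ring
    have d0 : 0 < m + κ * (n * f) := by positivity
    have fnn' : 0 ≤ f' := fnn.trans fm
    have d1 : 0 < m + κ * (n * f') := by positivity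
    have dm : m + κ * (n * f) ≤ m + κ * (n * f') := by gcongr
    set β := (1 - f') / (m + κ * (n * f')) with hβ
    set β0 := (1 - f) / (m + κ * (n * f)) with hβ0
    have hβpos : 0 < β := div_pos (by linarith) d1
    have hβle : β ≤ β0 := div_le_div₀ (by linarith) (by linarith) d0 dm
    have step : EE w (fun T : Fin n → α => ind (¬ CC w B m κ (s+1) T))
        + β^2 * EE w (fun T : Fin n → α => X' T^2 * ind (CC w B m κ (s+1) T))
        ≤ EE w (fun T : Fin n → α => ind (¬ CC w B m κ s T))
        + β^2 * EE w (fun T : Fin n → α => X' T^2 * ind (CC w B m κ s T)) := by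
      rw [← EE_mul, ← EE_mul, ← EE_add, ← EE_add]
      apply EE_mono hw
      intro T
      by_cases hc : CC w B m κ s T
      · by_cases hc' : CC w B m κ (s+1) T
        · rw [ind_pos hc, ind_pos hc', ind_neg (not_not.2 hc), ind_neg (not_not.2 hc')]
        · rw [ind_pos hc, ind_neg hc', ind_neg (not_not.2 hc), ind_pos hc']
          have : m + κ * (n * f') ≤ |NN B (s+1) T - n * f'| := by
            by_contra hlt
            push Not at hlt
            apply hc'
            intro t ht
            rcases Nat.lt_or_ge s t with h | h
            · obtain rfl : t = s + 1 := by omega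
              exact hlt
            · exact hc t h
          have hx : X' T = (NN B (s+1) T - n * f') / (1 - f') := xi_sum B (s+1) f1 T
          have : 1 ≤ |β * X' T| := by
            rw [hx, hβ, div_mul_div_comm, mul_comm (m + _), mul_div_mul_left _ _ g1, abs_div,
              abs_of_pos d1, le_div_iff₀ d1, one_mul]
            exact this
          have : 1 ≤ (β * X' T)^2 := by rw [← sq_abs]; nlinarith
          nlinarith
      · have hc' : ¬ CC w B m κ (s+1) T := fun h => hc fun t ht => h t (by omega)
        rw [ind_neg hc, ind_neg hc', ind_pos hc, ind_pos hc']
    have hU : 0 ≤ EE w (fun T => X T ^ 2 * ind (CC w B m κ s T)) := by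
      have := EE_mono (n := n) hw (F := fun _ => 0) (G := fun T => X T ^ 2 * ind (CC w B m κ s T))
        (fun T => mul_nonneg (sq_nonneg _) (ind_nonneg _))
      rwa [EE_const h1] at this
    have last : β^2 * (n * (1/(1-f') - 1/(1-f))) ≤ (1/κ) * (1 / (m + κ * (n * f)) - 1 / (m + κ * (n * f'))) := by
      have e1 : (1/κ) * (1 / (m + κ * (n * f)) - 1 / (m + κ * (n * f')))
          = n * (f' - f) / ((m + κ * (n * f)) * (m + κ * (n * f'))) := by
        field_simp; ring
      have e2 : β^2 * (n * (1/(1-f') - 1/(1-f))) = ((1-f')/(1-f)) * (n * (f' - f) / ((m + κ * (n * f')) * (m + κ * (n * f')))) := by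
        rw [hβ]; field_simp; ring
      rw [e1, e2]
      have nn : (0:ℝ) ≤ n * (f' - f) := mul_nonneg (Nat.cast_nonneg _) (by linarith)
      calc _ ≤ 1 * (n * (f' - f) / ((m + κ * (n * f')) * (m + κ * (n * f')))) := by
            apply mul_le_mul_of_nonneg_right _ (by positivity)
            rw [div_le_one (by linarith)]; linarith
        _ ≤ _ := by
            rw [one_mul]
            apply div_le_div_of_nonneg_left nn (by positivity)
            gcongr
    have h2 : β^2 * EE w (fun T => X T ^ 2 * ind (CC w B m κ s T))
        ≤ β0^2 * EE w (fun T => X T ^ 2 * ind (CC w B m κ s T)) := by gcongr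
    have h3 := mul_le_mul_of_nonneg_left key (sq_nonneg β)
    have h4 : (1/κ) * (1/m - 1/(m + κ * (n * f))) + (1/κ) * (1 / (m + κ * (n * f)) - 1 / (m + κ * (n * f')))
      = (1/κ) * (1/m - 1/(m + κ * (n * f'))) := by ring
    linarith

lemma hajek_renyi' {w : α → ℝ} (hw : ∀ a, 0 ≤ w a) (h1 : ∑ a, w a = 1) (B : ℕ → α → Prop)
    (hB0 : ∀ a, ¬ B 0 a) (hB : ∀ t a, B t a → B (t+1) a) (m κ : ℝ) (hm : 0 < m) (hκ : 0 < κ)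
    (s : ℕ) (hF : ∀ t ≤ s, FF w B t < 1) :
    EE w (fun T : Fin n → α => ind (¬ CC w B m κ s T)) ≤ 1 / (κ * m) := by
  have h := hajek_renyi (n := n) hw h1 B hB0 hB m κ hm hκ s hF
  have hU : 0 ≤ EE w (fun T : Fin n → α => (∑ j, xi w B s (T j))^2 * ind (CC w B m κ s T)) := by
    have := EE_mono (n := n) hw (F := fun _ => 0)
      (G := fun T => (∑ j, xi w B s (T j))^2 * ind (CC w B m κ s T))
      (fun T => mul_nonneg (sq_nonneg _) (ind_nonneg _))
    rwa [EE_const h1] at this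
  have fnn : 0 ≤ FF w B s := Finset.sum_nonneg fun a _ => mul_nonneg (hw a) (ind_nonneg _)
  have h2 : 0 ≤ (1/κ) * (1 / (m + κ * (n * FF w B s))) := by positivity
  have h3 : 0 ≤ ((1 - FF w B s) / (m + κ * (n * FF w B s)))^2 *
    EE w (fun T : Fin n → α => (∑ j, xi w B s (T j))^2 * ind (CC w B m κ s T)) := by positivity
  have h4 : 1 / (κ * m) = 1/κ * (1/m) := by field_simp
  rw [h4]
  linarith

end IID


/-- single ball weights -/
noncomputable def om (k : ℕ) (p : ℝ) (i : ℕ) : ℝ := p * (1-p)^i / (1 - (1-p)^k)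

/-- single ball weights on `Fin k` -/
noncomputable def ww (k : ℕ) (p : ℝ) (a : Fin k) : ℝ := om k p a

lemma Pr_EE (k : ℕ) (p : ℝ) (E : (Fin (k-1) → Fin k) → Prop) :
    Pr k p E = EE (ww k p) (fun T => ind (E T)) := rfl

lemma wt_ww (k : ℕ) (p : ℝ) (T : Fin (k-1) → Fin k) : wt k p T = ∏ j, ww k p (T j) := rfl

lemma om_pos {p : ℝ} (hp : 0 < p) (hp1 : p < 1) {k : ℕ} (hk : 0 < k) (i : ℕ) : 0 < om k p i := by
  have := denom_pos hp hp1.le hk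
  have : 0 < 1 - p := by linarith
  unfold om; positivity

lemma om_anti {p : ℝ} (hp : 0 < p) (hp1 : p < 1) {k : ℕ} (hk : 0 < k) : Antitone (om k p) := by
  intro a b hab
  have := denom_pos hp hp1.le hk
  unfold om
  have := pow_le_pow_of_le_one (a := 1-p) (by linarith) (by linarith) hab
  exact div_le_div_of_nonneg_right (mul_le_mul_of_nonneg_left this hp.le) (denom_pos hp hp1.le hk).le

lemma om_sum {p : ℝ} (k t : ℕ) :
    ∑ i ∈ range t, om k p i = (1 - (1-p)^t) / (1 - (1-p)^k) := by
  unfold om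
  rw [← Finset.sum_div, ← Finset.mul_sum]
  have := mul_neg_geom_sum (1-p) t
  rw [← this]; ring_nf

lemma ww_sum {p : ℝ} (hp : 0 < p) (hp1 : p < 1) {k : ℕ} (hk : 0 < k) : ∑ a, ww k p a = 1 := by
  unfold ww
  rw [Fin.sum_univ_eq_sum_range (om k p) k, om_sum, div_self (denom_pos hp hp1.le hk).ne']

lemma sum_ind_lt (K t : ℕ) (ht : t ≤ K) (f : ℕ → ℝ) :
    ∑ i ∈ range K, f i * ind (i < t) = ∑ i ∈ range t, f i := by
  rw [← Finset.sum_subset (Finset.range_subset_range.2 ht)]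
  · apply Finset.sum_congr rfl
    intro i hi
    rw [ind_pos (Finset.mem_range.1 hi), mul_one]
  · intro i _ hi
    rw [ind_neg (by simpa using hi), mul_zero]

lemma FF_left (K t : ℕ) (ht : t ≤ K) (p : ℝ) :
    FF (ww K p) (fun t (a : Fin K) => (a:ℕ) < t) t = ∑ i ∈ range t, om K p i := by
  unfold FF ww
  rw [Fin.sum_univ_eq_sum_range (fun i => om K p i * ind (i < t)) K, sum_ind_lt K t ht]

lemma FF_right (K r : ℕ) (hr : r ≤ K) (p : ℝ) :
    FF (ww K p) (fun r (a : Fin K) => K ≤ (a:ℕ) + r) r = ∑ i ∈ range r, om K p (K-1-i) := by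
  unfold FF ww
  rw [Fin.sum_univ_eq_sum_range (fun i => om K p i * ind (K ≤ i + r)) K, ← sum_ind_lt K r hr,
    ← Finset.sum_range_reflect]
  apply Finset.sum_congr rfl
  intro i hi
  have := Finset.mem_range.1 hi
  congr 1
  apply ind_congr
  omega

lemma avg_anti (a : ℕ → ℝ) (ha : Antitone a) (t h : ℕ) (hth : t ≤ h) :
    (t:ℝ) * ∑ i ∈ range h, a i ≤ h * ∑ i ∈ range t, a i := by
  induction h, hth using Nat.le_induction with
  | base => exact le_rfl
  | succ h hth ih =>
    rw [Finset.sum_range_succ]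
    push_cast
    have : (t:ℝ) * a h ≤ ∑ i ∈ range t, a i := by
      have := Finset.card_nsmul_le_sum (range t) a (a h) (fun i hi => ha (by
        have := Finset.mem_range.1 hi; omega))
      simpa using this
    linarith

lemma avg_mono (a : ℕ → ℝ) (ha : Monotone a) (t h : ℕ) (hth : t ≤ h) :
    h * ∑ i ∈ range t, a i ≤ (t:ℝ) * ∑ i ∈ range h, a i := by
  have := avg_anti (fun i => - a i) (fun x y hxy => neg_le_neg (ha hxy)) t h hth
  simp only [Finset.sum_neg_distrib] at this
  linarith

lemma NN_card {n K : ℕ} (B : ℕ → Fin K → Prop) [∀ t, DecidablePred (B t)] (t : ℕ) (T : Fin n → Fin K) :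
    NN B t T = ((Finset.univ.filter (fun j => B t (T j))).card : ℝ) := by
  unfold NN
  rw [Finset.card_filter]
  push_cast
  apply Finset.sum_congr rfl
  intro j _
  by_cases h : B t (T j)
  · rw [ind_pos h, if_pos h]
  · rw [ind_neg h, if_neg h]

lemma good_prob {h m : ℕ} (hh : 0 < h) (hm : 0 < m) {p : ℝ} (hp : 0 < p) (hp1 : p < 1) :
    1 - 4 / ((1 - (1-p)^h) * m) ≤ Pr (2*h) p (GoodEvt (2*h) m) := by
  set K := 2*h with hKdef
  have hK : 0 < K := by omega
  set q := 1 - p with hq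
  have hq0 : 0 < q := by simp [hq]; linarith
  have hq1 : q < 1 := by simp [hq]; linarith
  set x := q^h with hx
  have hx0 : 0 < x := pow_pos hq0 h
  have hx1 : x < 1 := pow_lt_one₀ hq0.le hq1 hh.ne'
  set κ := (1 - x)/2 with hκ
  have hκ0 : 0 < κ := by simp only [hκ]; linarith
  have hm' : (0:ℝ) < m := by exact_mod_cast hm
  have hw : ∀ a, 0 ≤ ww K p a := fun a => (om_pos hp hp1 hK a).le
  have h1 := ww_sum hp hp1 hK
  have hFh : ∑ i ∈ range h, om K p i = 1 / (1 + x) := by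
    rw [om_sum]
    have : (1-p)^K = x * x := by rw [← hq, hKdef, two_mul, pow_add]
    rw [this, ← hq, ← hx]
    have : 1 - x * x ≠ 0 := by nlinarith
    have : 1 - x ≠ 0 := by linarith
    rw [div_eq_div_iff (by nlinarith) (by linarith)]; ring
  have hKs : ∑ i ∈ range K, om K p i = 1 := by
    rw [om_sum, div_self (denom_pos hp hp1.le hK).ne']
  have hGh : ∑ i ∈ range h, om K p (K-1-i) = x / (1 + x) := by
    have e1 : ∑ i ∈ range h, om K p (K-1-i) = ∑ i ∈ range h, om K p (h + i) := by
      rw [← Finset.sum_range_reflect]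
      apply Finset.sum_congr rfl
      intro i hi
      have := Finset.mem_range.1 hi
      congr 1; omega
    have e2 := Finset.sum_range_add (om K p) h h
    rw [← two_mul, ← hKdef, hKs, hFh] at e2
    rw [e1]
    have : (1:ℝ) - 1/(1+x) = x/(1+x) := by field_simp; ring
    linarith
  set BL : ℕ → Fin K → Prop := fun t a => (a:ℕ) < t with hBL
  set BR : ℕ → Fin K → Prop := fun r a => K ≤ (a:ℕ) + r with hBR
  have hx2 : 0 < 1 / (1+x) := by positivity
  have hxs : 1 / (1+x) + x/(1+x) = 1 := by field_simp
  have L := hajek_renyi' (n := K-1) hw h1 BL (fun a => by simp [hBL]) (fun t a hh => by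
    simp only [hBL] at *; omega) m κ hm' hκ0 h (by
      intro t ht
      rw [FF_left K t (by omega) p]
      calc _ ≤ ∑ i ∈ range h, om K p i := Finset.sum_le_sum_of_subset_of_nonneg
            (Finset.range_subset_range.2 ht) (fun i _ _ => (om_pos hp hp1 hK i).le)
        _ < 1 := by rw [hFh, div_lt_one (by linarith)]; linarith)
  have R := hajek_renyi' (n := K-1) hw h1 BR (fun a => by simp [hBR]) (fun t a hh => by
    simp only [hBR] at *; omega) m κ hm' hκ0 h (by
      intro t ht
      rw [FF_right K t (by omega) p]
      calc _ ≤ ∑ i ∈ range h, om K p (K-1-i) := Finset.sum_le_sum_of_subset_of_nonneg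
            (Finset.range_subset_range.2 ht) (fun i _ _ => (om_pos hp hp1 hK _).le)
        _ < 1 := by rw [hGh]; linarith)
  have hh' : (0:ℝ) < h := by exact_mod_cast hh
  have hKr : (K:ℝ) = 2 * h := by rw [hKdef]; push_cast; ring
  have hn : ((K-1:ℕ):ℝ) = K - 1 := by rw [Nat.cast_sub (by omega)]; simp
  have main : ∀ T : Fin (K-1) → Fin K, 1 - (ind (¬ CC (ww K p) BL m κ h T) +
      ind (¬ CC (ww K p) BR m κ h T)) ≤ ind (GoodEvt K m T) := by
    intro T
    by_cases c1 : CC (ww K p) BL m κ h T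
    · by_cases c2 : CC (ww K p) BR m κ h T
      · have : GoodEvt K m T := by
          intro t ht
          by_cases hth : t ≤ h
          · have c := c1 t hth
            rw [NN_card, FF_left K t (by omega) p, abs_lt] at c
            have av := avg_anti (om K p) (om_anti hp hp1 hK) t h hth
            rw [hFh] at av
            have F1 : ∑ i ∈ range t, om K p i ≤ 1 := by
              rw [← hKs]
              exact Finset.sum_le_sum_of_subset_of_nonneg
                (Finset.range_subset_range.2 (by omega)) (fun i _ _ => (om_pos hp hp1 hK i).le)
            have F0 : 0 ≤ ∑ i ∈ range t, om K p i :=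
              Finset.sum_nonneg fun i _ => (om_pos hp hp1 hK i).le
            set F := ∑ i ∈ range t, om K p i
            set N := (Finset.univ.filter (fun j => BL t (T j))).card with hN
            have a1 : (t:ℝ) ≤ (1 - κ) * (K * F) := by
              have : (t:ℝ) * (1/(1+x)) * (1 + x) ≤ h * F * (1+x) := by gcongr
              have e : (t:ℝ) * (1/(1+x)) * (1 + x) = t := by field_simp
              rw [e] at this
              rw [hKr, hκ]; linarith
            have a2 : (t:ℝ) < N + m + 1 := by
              have := c.1
              rw [hn] at this
              nlinarith
            have a3 : t < N + m + 1 := by exact_mod_cast a2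
            omega
          · have c := c2 (K - t) (by omega)
            rw [NN_card, FF_right K (K-t) (by omega) p, abs_lt] at c
            have av := avg_mono (fun i => om K p (K-1-i)) (fun a b hab =>
              om_anti hp hp1 hK (by omega)) (K-t) h (by omega)
            rw [hGh] at av
            have F0 : 0 ≤ ∑ i ∈ range (K-t), om K p (K-1-i) :=
              Finset.sum_nonneg fun i _ => (om_pos hp hp1 hK _).le
            set F := ∑ i ∈ range (K-t), om K p (K-1-i)
            set N := (Finset.univ.filter (fun j => BR (K-t) (T j))).card with hN
            have hNe := Finset.card_filter_add_card_filter_not (s := (Finset.univ : Finset (Fin (K-1))))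
              (fun j => (T j : ℕ) < t)
            have hNe2 : (Finset.univ.filter (fun j => ¬ ((T j : ℕ) < t))).card = N := by
              rw [hN]; congr 1; ext j; simp only [hBR, Finset.mem_filter, Finset.mem_univ, true_and]
              omega
            rw [hNe2] at hNe
            simp only [Finset.card_univ, Fintype.card_fin] at hNe
            have a1 : (1 + κ) * (K * F) ≤ ((K - t : ℕ) : ℝ) := by
              have e0 : K * F ≤ ((K - t : ℕ) : ℝ) * (2 * (x/(1+x))) := by rw [hKr]; linarith
              have e1 : (1 + κ) * (2 * (x/(1+x))) ≤ 1 := by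
                rw [hκ]
                have : (1 + (1 - x) / 2) * (2 * (x / (1 + x))) = (3 - x) * x / (1+x) := by
                  field_simp; ring
                rw [this, div_le_one (by linarith)]
                nlinarith [sq_nonneg (1-x)]
              calc (1 + κ) * (K * F) ≤ (1+κ) * (((K - t : ℕ) : ℝ) * (2 * (x/(1+x)))) := by gcongr
                _ = ((K - t : ℕ) : ℝ) * ((1 + κ) * (2 * (x/(1+x)))) := by ring
                _ ≤ ((K - t : ℕ) : ℝ) * 1 := by gcongr
                _ = _ := mul_one _
            have a2 : (N:ℝ) < ((K - t : ℕ) : ℝ) + m := by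
              have := c.2
              rw [hn] at this
              nlinarith
            have a3 : N < K - t + m := by exact_mod_cast a2
            omega
        rw [ind_pos this]
        have := ind_nonneg (¬ CC (ww K p) BL m κ h T)
        have := ind_nonneg (¬ CC (ww K p) BR m κ h T)
        linarith
      · rw [ind_pos c2]
        have := ind_nonneg (¬ CC (ww K p) BL m κ h T)
        have := ind_nonneg (GoodEvt K m T)
        linarith
    · rw [ind_pos c1]
      have := ind_nonneg (¬ CC (ww K p) BR m κ h T)
      have := ind_nonneg (GoodEvt K m T)
      linarith
  have fin := EE_mono hw main
  rw [EE_sub, EE_const h1, EE_add] at fin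
  rw [Pr_EE]
  have e : 4 / ((1 - x) * m) = 1/(κ * m) + 1/(κ*m) := by
    rw [hκ]; have : 1 - x ≠ 0 := by linarith
    field_simp; ring
  rw [e]
  linarith


/-- law of `S` under the product weights -/
noncomputable def lawS {K n : ℕ} (w : Fin K → ℝ) (S : (Fin n → Fin K) → ℝ) : MeasureTheory.Measure ℝ :=
  ∑ T : Fin n → Fin K, ENNReal.ofReal (∏ j, w (T j)) • MeasureTheory.Measure.dirac (S T)

lemma lawS_apply {K n : ℕ} {w : Fin K → ℝ} (hw : ∀ a, 0 ≤ w a) (S : (Fin n → Fin K) → ℝ)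
    (A : Set ℝ) (hA : MeasurableSet A) :
    lawS w S A = ENNReal.ofReal (EE w (fun T => ind (S T ∈ A))) := by
  unfold lawS EE
  rw [MeasureTheory.Measure.finsetSum_apply, ENNReal.ofReal_sum_of_nonneg]
  · apply Finset.sum_congr rfl
    intro T _
    rw [MeasureTheory.Measure.smul_apply, MeasureTheory.Measure.dirac_apply' _ hA,
      ENNReal.ofReal_mul (Finset.prod_nonneg fun _ _ => hw _), smul_eq_mul]
    congr 1
    beta_reduce
    by_cases h : S T ∈ A
    · rw [ind_pos h]; simp [h]
    · rw [ind_neg h]; simp [h]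
  · intro T _
    exact mul_nonneg (Finset.prod_nonneg fun _ _ => hw _) (ind_nonneg _)

lemma lawS_prob {K n : ℕ} {w : Fin K → ℝ} (hw : ∀ a, 0 ≤ w a) (h1 : ∑ a, w a = 1)
    (S : (Fin n → Fin K) → ℝ) : MeasureTheory.IsProbabilityMeasure (lawS w S) := by
  constructor
  rw [lawS_apply hw S _ MeasurableSet.univ]
  have : (fun T => ind (S T ∈ (Set.univ : Set ℝ))) = fun _ : Fin n → Fin K => 1 :=
    funext fun T => ind_pos (Set.mem_univ _)
  rw [this, EE_const h1]; simp

lemma lawS_charFun {K n : ℕ} {w : Fin K → ℝ} (hw : ∀ a, 0 ≤ w a) (f : Fin K → ℝ) (d t : ℝ) :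
    MeasureTheory.charFun (lawS w (fun T : Fin n → Fin K => ∑ j, f (T j) + d)) t
      = Complex.exp (t * d * Complex.I) *
        (∑ a, (w a : ℂ) * Complex.exp (t * f a * Complex.I)) ^ n := by
  rw [MeasureTheory.charFun_apply_real]
  unfold lawS
  rw [MeasureTheory.integral_finsetSum_measure]
  · simp_rw [MeasureTheory.integral_smul_measure, MeasureTheory.integral_dirac]
    have hpow : (∑ a, (w a : ℂ) * Complex.exp (t * f a * Complex.I)) ^ n
        = ∏ _j : Fin n, ∑ a, (w a : ℂ) * Complex.exp (t * f a * Complex.I) := by simp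
    rw [hpow, Finset.prod_univ_sum, Fintype.piFinset_univ, Finset.mul_sum]
    apply Finset.sum_congr rfl
    intro T _
    rw [ENNReal.toReal_ofReal (Finset.prod_nonneg fun _ _ => hw _), Finset.prod_mul_distrib,
      ← Complex.exp_sum, Complex.real_smul]
    push_cast
    rw [mul_left_comm, ← Complex.exp_add]
    congr 2
    rw [mul_add, add_mul, Finset.mul_sum, Finset.sum_mul, add_comm]
  · intro T _
    apply MeasureTheory.Integrable.smul_measure _ ENNReal.ofReal_ne_top
    exact MeasureTheory.integrable_dirac (by simp)

lemma pow_sub_pow_le (a b : ℂ) (ha : ‖a‖ ≤ 1) (hb : ‖b‖ ≤ 1) (n : ℕ) :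
    ‖a^n - b^n‖ ≤ n * ‖a - b‖ := by
  induction n with
  | zero => simp
  | succ n ih =>
    have : a^(n+1) - b^(n+1) = a * (a^n - b^n) + (a - b) * b^n := by ring
    rw [this]
    refine (norm_add_le _ _).trans ?_
    rw [norm_mul, norm_mul, norm_pow]
    have h1 : ‖b‖^n ≤ 1 := pow_le_one₀ (norm_nonneg _) hb
    have h2 : ‖a‖ * ‖a^n - b^n‖ ≤ ‖a^n - b^n‖ := mul_le_of_le_one_left (norm_nonneg _) ha
    have h3 : ‖a - b‖ * ‖b‖^n ≤ ‖a-b‖ := mul_le_of_le_one_right (norm_nonneg _) h1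
    push_cast
    linarith

lemma exp_taylor3 (y : ℝ) (hy : |y| ≤ 1) :
    ‖Complex.exp (y * Complex.I) - (1 + y * Complex.I - (y:ℂ)^2/2)‖ ≤ |y|^3 := by
  have hn : ‖(y:ℂ) * Complex.I‖ = |y| := by simp
  have h := Complex.exp_bound (x := y * Complex.I) (by rw [hn]; exact hy) (n := 3) (by norm_num)
  rw [hn] at h
  have e : ∑ m ∈ range 3, ((y:ℂ) * Complex.I)^m / (m.factorial : ℂ) = 1 + y * Complex.I - (y:ℂ)^2/2 := by
    simp [Finset.sum_range_succ, mul_pow, Nat.factorial]; ring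
  rw [e] at h
  refine h.trans ?_
  have : |y|^3 * (((3:ℕ).succ : ℝ) * ((Nat.factorial 3 : ℝ) * (3:ℕ))⁻¹) ≤ |y|^3 * 1 := by
    apply mul_le_mul_of_nonneg_left _ (by positivity)
    norm_num [Nat.factorial]
  linarith

lemma charFun_est {K n : ℕ} {w : Fin K → ℝ} (hw : ∀ a, 0 ≤ w a) (h1 : ∑ a, w a = 1)
    (f : Fin K → ℝ) (hm : ∑ a, w a * f a = 0) (hv : n * ∑ a, w a * f a ^ 2 = 1) (δ t : ℝ)
    (hδ : ∀ a, |f a| ≤ δ) (htδ : |t| * δ ≤ 1) :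
    ‖(∑ a, (w a : ℂ) * Complex.exp (t * f a * Complex.I)) ^ n - Complex.exp (-(t:ℂ)^2/2)‖
      ≤ |t|^3 * δ + t^4 * δ^2 := by
  have hn : (0:ℝ) < n := by
    rcases Nat.eq_zero_or_pos n with h | h
    · subst h; simp at hv
    · exact_mod_cast h
  set V := ∑ a, w a * f a ^ 2 with hV
  have hVe : V = 1 / n := by field_simp; linarith
  have hδ0 : 0 ≤ δ := by
    by_contra hneg
    have : ∀ a, False := fun a => by have := hδ a; have := abs_nonneg (f a); linarith
    have : IsEmpty (Fin K) := ⟨this⟩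
    simp at h1
  have hVle : V ≤ δ^2 := by
    calc V ≤ ∑ a, w a * δ^2 := Finset.sum_le_sum fun a _ =>
          mul_le_mul_of_nonneg_left (by rw [← sq_abs]; gcongr; exact hδ a) (hw a)
      _ = δ^2 := by rw [← Finset.sum_mul, h1, one_mul]
  set φ := ∑ a, (w a : ℂ) * Complex.exp (t * f a * Complex.I) with hφ
  have hφ1 : ‖φ‖ ≤ 1 := by
    refine (norm_sum_le _ _).trans ?_
    rw [← h1]
    apply Finset.sum_le_sum
    intro a _
    rw [norm_mul, ← Complex.ofReal_mul, Complex.norm_exp_ofReal_mul_I, mul_one, Complex.norm_real,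
      Real.norm_of_nonneg (hw a)]
  set b : ℝ := Real.exp (-(t^2 * V/2)) with hb
  have hVnn : 0 ≤ V := Finset.sum_nonneg fun a _ => mul_nonneg (hw a) (sq_nonneg _)
  have hbn : ‖(b:ℂ)‖ ≤ 1 := by
    rw [Complex.norm_real, Real.norm_of_nonneg (Real.exp_pos _).le, Real.exp_le_one_iff]
    have : 0 ≤ t^2 * V / 2 := by positivity
    linarith
  have hbp : (b:ℂ)^n = Complex.exp (-(t:ℂ)^2/2) := by
    rw [hb, ← Complex.ofReal_pow, ← Real.exp_nat_mul, Complex.ofReal_exp, hVe]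
    congr 1
    push_cast
    have : (n:ℂ) ≠ 0 := by exact_mod_cast hn.ne'
    field_simp
  have d1 : ‖φ - ((1 - t^2 * V/2 : ℝ) : ℂ)‖ ≤ |t|^3 * δ * V := by
    have e : φ - ((1 - t^2 * V/2 : ℝ) : ℂ) = ∑ a, (w a : ℂ) * (Complex.exp ((t * f a : ℝ) * Complex.I)
        - (1 + (t * f a : ℝ) * Complex.I - ((t * f a : ℝ):ℂ)^2/2)) := by
      have h1c : ∑ a, (w a : ℂ) = 1 := by exact_mod_cast congrArg (fun x : ℝ => (x:ℂ)) h1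
      have hmc : ∑ a, (w a : ℂ) * (f a : ℂ) = 0 := by exact_mod_cast congrArg (fun x : ℝ => (x:ℂ)) hm
      have hVc : (V:ℂ) = ∑ a, (w a : ℂ) * (f a : ℂ)^2 := by rw [hV]; push_cast; rfl
      have : ∀ a, (w a : ℂ) * (Complex.exp ((t * f a : ℝ) * Complex.I)
        - (1 + (t * f a : ℝ) * Complex.I - ((t * f a : ℝ):ℂ)^2/2))
        = (w a : ℂ) * Complex.exp (t * f a * Complex.I) - ((w a : ℂ) + (w a : ℂ) * (f a : ℂ) * (t * Complex.I)
          - (w a : ℂ) * (f a : ℂ)^2 * (t^2/2)) := by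
        intro a; push_cast; ring
      simp_rw [this]
      rw [Finset.sum_sub_distrib, Finset.sum_sub_distrib, Finset.sum_add_distrib, ← Finset.sum_mul,
        ← Finset.sum_mul, h1c, hmc, ← hVc]
      push_cast; ring
    rw [e]
    refine (norm_sum_le _ _).trans ?_
    rw [hV, Finset.mul_sum]
    apply Finset.sum_le_sum
    intro a _
    rw [norm_mul, Complex.norm_real, Real.norm_of_nonneg (hw a)]
    have ht : |t * f a| ≤ 1 := by
      rw [abs_mul]; refine le_trans ?_ htδ; gcongr; exact hδ a
    calc w a * _ ≤ w a * |t * f a|^3 := mul_le_mul_of_nonneg_left (exp_taylor3 _ ht) (hw a)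
      _ = (w a * |t|^3 * f a^2) * |f a| := by rw [abs_mul, mul_pow, ← sq_abs (f a)]; ring
      _ ≤ (w a * |t|^3 * f a^2) * δ := by
        apply mul_le_mul_of_nonneg_left (hδ a)
        have := hw a; positivity
      _ = _ := by ring
  have hts : t^2 * V / 2 ≤ 1 := by
    have : (|t| * δ)^2 ≤ 1 := by
      have : 0 ≤ |t| * δ := by positivity
      nlinarith
    rw [mul_pow, sq_abs] at this
    nlinarith [mul_le_mul_of_nonneg_left hVle (sq_nonneg t)]
  have d2 : ‖((1 - t^2 * V/2 : ℝ) : ℂ) - (b:ℂ)‖ ≤ (t^2 * V/2)^2 := by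
    rw [← Complex.ofReal_sub, Complex.norm_real, Real.norm_eq_abs, abs_sub_comm]
    have := Real.abs_exp_sub_one_sub_id_le (x := -(t^2 * V/2)) (by
      rw [abs_neg, abs_of_nonneg (by positivity)]; exact hts)
    rw [neg_sq] at this
    convert this using 2
    rw [hb]; ring
  rw [← hbp]
  refine (pow_sub_pow_le _ _ hφ1 hbn n).trans ?_
  have d3 : ‖φ - b‖ ≤ |t|^3 * δ * V + (t^2 * V/2)^2 := by
    have := norm_add_le (φ - ((1 - t^2 * V/2 : ℝ) : ℂ)) (((1 - t^2 * V/2 : ℝ) : ℂ) - (b:ℂ))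
    rw [sub_add_sub_cancel] at this
    linarith
  calc n * ‖φ - b‖ ≤ n * (|t|^3 * δ * V + (t^2 * V/2)^2) := by gcongr
    _ = |t|^3 * δ * (n * V) + t^4/4 * V * (n * V) := by ring
    _ = |t|^3 * δ + t^4/4 * V := by rw [hv]; ring
    _ ≤ |t|^3 * δ + t^4 * δ^2 := by
      have h4 : (0:ℝ) ≤ t^4 := by positivity
      nlinarith [mul_le_mul_of_nonneg_left hVle h4, mul_nonneg h4 hVnn]

lemma stdGaussCDF_eq (u : ℝ) :
    ENNReal.ofReal (stdGaussCDF u) = ProbabilityTheory.gaussianReal 0 1 (Set.Iic u) := by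
  rw [ProbabilityTheory.gaussianReal_apply_eq_integral _ one_ne_zero]
  congr 1
  unfold stdGaussCDF
  apply MeasureTheory.integral_congr_ae
  apply MeasureTheory.ae_of_all
  intro t
  simp only [ProbabilityTheory.gaussianPDFReal]
  simp
  ring

lemma stdGaussCDF_nonneg (u : ℝ) : 0 ≤ stdGaussCDF u := by
  unfold stdGaussCDF
  apply MeasureTheory.integral_nonneg
  intro t
  positivity

lemma clt_array (N K : ℕ → ℕ) (w f : ∀ k, Fin (K k) → ℝ) (hw : ∀ k a, 0 ≤ w k a)
    (h1 : ∀ k, ∑ a, w k a = 1) (hm : ∀ k, ∑ a, w k a * f k a = 0)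
    (hv : ∀ k, N k * ∑ a, w k a * f k a ^ 2 = 1) (δ d : ℕ → ℝ) (hδ : ∀ k a, |f k a| ≤ δ k)
    (hδ0 : Tendsto δ atTop (𝓝 0)) (hd : Tendsto d atTop (𝓝 0)) (u : ℝ) :
    Tendsto (fun k => EE (n := N k) (w k) (fun T => ind (∑ j, f k (T j) + d k ≤ u))) atTop
      (𝓝 (stdGaussCDF u)) := by
  let μs : ℕ → MeasureTheory.ProbabilityMeasure ℝ := fun k =>
    ⟨lawS (w k) (fun T : Fin (N k) → Fin (K k) => ∑ j, f k (T j) + d k), lawS_prob (hw k) (h1 k) _⟩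
  let μ0 : MeasureTheory.ProbabilityMeasure ℝ := ⟨ProbabilityTheory.gaussianReal 0 1, inferInstance⟩
  have hlim : Tendsto μs atTop (𝓝 μ0) := by
    rw [MeasureTheory.ProbabilityMeasure.tendsto_iff_tendsto_charFun]
    intro t
    show Tendsto (fun k => MeasureTheory.charFun (lawS (w k)
      (fun T : Fin (N k) → Fin (K k) => ∑ j, f k (T j) + d k)) t) atTop
      (𝓝 (MeasureTheory.charFun (ProbabilityTheory.gaussianReal 0 1) t))
    rw [ProbabilityTheory.charFun_gaussianReal]
    simp_rw [lawS_charFun (hw _)]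
    have e : Complex.exp (t * (0:ℝ) * Complex.I - (1:NNReal) * (t:ℂ)^2/2)
        = Complex.exp (t * (0:ℝ) * Complex.I) * Complex.exp (-(t:ℂ)^2/2) := by
      rw [← Complex.exp_add]; congr 1; simp; ring
    rw [e]
    apply Tendsto.mul
    · have hc : Continuous (fun x : ℝ => Complex.exp (t * x * Complex.I)) := by fun_prop
      exact (hc.tendsto 0).comp hd
    · rw [tendsto_iff_norm_sub_tendsto_zero]
      have hb : Tendsto (fun k => |t|^3 * δ k + t^4 * δ k^2) atTop (𝓝 0) := by
        have := (hδ0.const_mul (|t|^3)).add ((hδ0.pow 2).const_mul (t^4))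
        simpa using this
      apply squeeze_zero' (Eventually.of_forall fun _ => norm_nonneg _) _ hb
      have hev : ∀ᶠ k in atTop, |t| * δ k ≤ 1 := by
        have := hδ0.const_mul |t|
        rw [mul_zero] at this
        exact (this.eventually (gt_mem_nhds zero_lt_one)).mono fun _ h => le_of_lt h
      filter_upwards [hev] with k hk
      exact charFun_est (hw k) (h1 k) (f k) (hm k) (hv k) (δ k) t (hδ k) hk
  have hfin := MeasureTheory.ProbabilityMeasure.tendsto_measure_of_null_frontier_of_tendsto' hlim
    (E := Set.Iic u) (by
      rw [frontier_Iic]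
      show ProbabilityTheory.gaussianReal 0 1 {u} = 0
      have := ProbabilityTheory.nullSingletonClass_gaussianReal (μ := 0) (v := 1) one_ne_zero
      exact MeasureTheory.measure_singleton u)
  have hfin2 : Tendsto (fun k => ENNReal.ofReal (EE (n := N k) (w k)
      (fun T => ind (∑ j, f k (T j) + d k ≤ u)))) atTop (𝓝 (ENNReal.ofReal (stdGaussCDF u))) := by
    rw [stdGaussCDF_eq]
    refine hfin.congr ?_
    intro k
    exact lawS_apply (hw k) _ _ measurableSet_Iic
  have h3 := (ENNReal.tendsto_toReal ENNReal.ofReal_ne_top).comp hfin2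
  rw [ENNReal.toReal_ofReal (stdGaussCDF_nonneg u)] at h3
  refine h3.congr ?_
  intro k
  simp only [Function.comp]
  rw [ENNReal.toReal_ofReal]
  have := EE_mono (n := N k) (hw k) (F := fun _ => 0) (G := fun T => ind (∑ j, f k (T j) + d k ≤ u))
    (fun T => ind_nonneg _)
  rwa [EE_const (h1 k)] at this


/-- single-ball expectation -/
noncomputable def AA (k : ℕ) (p : ℝ) (g : ℕ → ℝ) : ℝ := ∑ i ∈ range k, om k p i * g i
/-- single-ball mean -/
noncomputable def e1 (k : ℕ) (p : ℝ) : ℝ := AA k p (fun i => (i:ℝ))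
/-- single-ball second moment -/
noncomputable def e2 (k : ℕ) (p : ℝ) : ℝ := AA k p (fun i => (i:ℝ)^2)
/-- single-ball variance -/
noncomputable def vv (k : ℕ) (p : ℝ) : ℝ := AA k p (fun i => ((i:ℝ) - e1 k p)^2)

lemma AA_fin (k : ℕ) (p : ℝ) (g : ℕ → ℝ) : AA k p g = ∑ a : Fin k, ww k p a * g a := by
  unfold AA ww
  rw [Fin.sum_univ_eq_sum_range (fun i => om k p i * g i) k]


lemma om_total {k : ℕ} {p : ℝ} (hp : 0 < p) (hp1 : p < 1) (hk : 0 < k) : ∑ i ∈ range k, om k p i = 1 := by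
  rw [om_sum, div_self (denom_pos hp hp1.le hk).ne']

lemma AA_bound {k : ℕ} {p : ℝ} (hp : 0 < p) (hp1 : p < 1) (hk : 0 < k) (g : ℕ → ℝ) (G : ℝ) (hg : ∀ i < k, g i ≤ G) : AA k p g ≤ G := by
  have : AA k p g ≤ ∑ i ∈ range k, om k p i * G := Finset.sum_le_sum fun i hi =>
    mul_le_mul_of_nonneg_left (hg i (Finset.mem_range.1 hi)) (om_pos hp hp1 hk i).le
  rwa [← Finset.sum_mul, om_total hp hp1 hk, one_mul] at this

lemma AA_nonneg {k : ℕ} {p : ℝ} (hp : 0 < p) (hp1 : p < 1) (hk : 0 < k) (g : ℕ → ℝ) (hg : ∀ i < k, 0 ≤ g i) : 0 ≤ AA k p g :=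
  Finset.sum_nonneg fun i hi => mul_nonneg (om_pos hp hp1 hk i).le (hg i (Finset.mem_range.1 hi))

lemma e1_nonneg {k : ℕ} {p : ℝ} (hp : 0 < p) (hp1 : p < 1) (hk : 0 < k) : 0 ≤ e1 k p := AA_nonneg hp hp1 hk _ fun i _ => Nat.cast_nonneg i
lemma e1_le {k : ℕ} {p : ℝ} (hp : 0 < p) (hp1 : p < 1) (hk : 0 < k) : e1 k p ≤ k := AA_bound hp hp1 hk _ _ fun i hi => by exact_mod_cast hi.le
lemma e2_le {k : ℕ} {p : ℝ} (hp : 0 < p) (hp1 : p < 1) (hk : 0 < k) : e2 k p ≤ (k:ℝ)^2 := AA_bound hp hp1 hk _ _ fun i hi => by gcongr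

lemma vv_eq {k : ℕ} {p : ℝ} (hp : 0 < p) (hp1 : p < 1) (hk : 0 < k) : vv k p = e2 k p - e1 k p ^ 2 := by
  unfold vv e2
  have h := om_total hp hp1 hk
  have : AA k p (fun i => ((i:ℝ) - e1 k p)^2) = AA k p (fun i => (i:ℝ)^2)
      - 2 * e1 k p * AA k p (fun i => (i:ℝ)) + e1 k p ^2 * ∑ i ∈ range k, om k p i := by
    unfold AA
    rw [Finset.mul_sum, Finset.mul_sum, ← Finset.sum_sub_distrib, ← Finset.sum_add_distrib]
    apply Finset.sum_congr rfl
    intros; ring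
  rw [this, h, show AA k p (fun i => (i:ℝ)) = e1 k p from rfl]
  ring

lemma ww_nonneg {k : ℕ} {p : ℝ} (hp : 0 < p) (hp1 : p < 1) (hk : 0 < k) (a : Fin k) : 0 ≤ ww k p a := (om_pos hp hp1 hk a).le

lemma cent_zero {k : ℕ} {p : ℝ} (hp : 0 < p) (hp1 : p < 1) (hk : 0 < k) : ∑ a : Fin k, ww k p a * ((e1 k p) - (a:ℕ)) = 0 := by
  simp_rw [mul_sub]
  rw [Finset.sum_sub_distrib, ← Finset.sum_mul, ww_sum hp hp1 hk, one_mul,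
    ← AA_fin k p (fun i => (i:ℝ))]
  exact sub_self _

lemma muM_eq {k : ℕ} {p : ℝ} (hp : 0 < p) (hp1 : p < 1) (hk : 0 < k) : muM k p = (Nat.choose k 2 : ℝ) - ((k-1 : ℕ):ℝ) - ((k-1:ℕ):ℝ) * e1 k p := by
  have h1 := ww_sum hp hp1 hk
  have : muM k p = EE (ww k p) (fun T : Fin (k-1) → Fin k => ((Nat.choose k 2 : ℝ) - ((k-1 : ℕ):ℝ)) -
      ∑ j, ((T j : ℕ):ℝ)) := by
    unfold muM EE
    apply Finset.sum_congr rfl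
    intro T _
    rw [wt_ww, Mval_eq]
  rw [this, EE_sub, EE_const h1, EE_sum]
  have : ∀ j : Fin (k-1), EE (ww k p) (fun T : Fin (k-1) → Fin k => ((T j : ℕ):ℝ)) = e1 k p := by
    intro j
    rw [EE_single h1 j (fun a => ((a:ℕ):ℝ))]
    exact (AA_fin k p (fun i => (i:ℝ))).symm
  simp_rw [this]
  simp

lemma Mval_sub_mu {k : ℕ} {p : ℝ} (hp : 0 < p) (hp1 : p < 1) (hk : 0 < k) (T : Fin (k-1) → Fin k) :
    (Mval k T : ℝ) - muM k p = ∑ j, (e1 k p - ((T j : ℕ):ℝ)) := by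
  rw [Mval_eq, muM_eq hp hp1 hk, Finset.sum_sub_distrib]
  simp

lemma vv_fin {k : ℕ} {p : ℝ} (hp : 0 < p) (hp1 : p < 1) (hk : 0 < k) : vv k p = ∑ a : Fin k, ww k p a * (e1 k p - (a:ℕ))^2 := by
  unfold vv
  rw [AA_fin]
  apply Finset.sum_congr rfl
  intros; ring

lemma varM_eq {k : ℕ} {p : ℝ} (hp : 0 < p) (hp1 : p < 1) (hk : 0 < k) : varM k p = ((k-1:ℕ):ℝ) * vv k p := by
  have h1 := ww_sum hp hp1 hk
  have : varM k p = EE (ww k p) (fun T : Fin (k-1) → Fin k => (∑ j, (e1 k p - ((T j : ℕ):ℝ)))^2) := by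
    unfold varM EE
    apply Finset.sum_congr rfl
    intro T _
    rw [wt_ww, Mval_sub_mu hp hp1 hk]
  rw [this, EE_sq_sum h1 (fun a => e1 k p - (a:ℕ)) (cent_zero hp hp1 hk), vv_fin hp hp1 hk]

lemma vv_le {k : ℕ} {p : ℝ} (hp : 0 < p) (hp1 : p < 1) (hk : 0 < k) : vv k p ≤ (k:ℝ)^2 := by
  rw [vv_eq hp hp1 hk]
  have := e2_le hp hp1 hk
  nlinarith [sq_nonneg (e1 k p)]

lemma pow_bound {k : ℕ} {p : ℝ} (hp : 0 < p) (hp1 : p < 1) (hk : 0 < k) (h : ℕ) : (1-p)^h ≤ 1 / (1 + p * h) := by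
  have b : 1 + (h:ℝ) * p ≤ (1+p)^h := one_add_mul_le_pow (by linarith) h
  have q0 : 0 < 1 - p := by linarith
  rw [le_div_iff₀ (by positivity)]
  calc (1-p)^h * (1 + p*h) ≤ (1-p)^h * (1+p)^h := by
        apply mul_le_mul_of_nonneg_left _ (by positivity); linarith
    _ = (1 - p^2)^h := by rw [← mul_pow]; ring_nf
    _ ≤ 1 := pow_le_one₀ (by nlinarith) (by nlinarith)

lemma om_zero_le {k : ℕ} {p : ℝ} (hp : 0 < p) (hp1 : p < 1) (hk : 0 < k) : om k p 0 ≤ (1 + p * k) / k := by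
  have hk' : (0:ℝ) < k := by exact_mod_cast hk
  have h := pow_bound hp hp1 hk k
  have hd := denom_pos hp hp1.le hk
  unfold om
  rw [pow_zero, mul_one, div_le_div_iff₀ hd hk']
  have : p * k / (1 + p * k) ≤ 1 - (1-p)^k := by
    have : p * k / (1 + p * k) = 1 - 1/(1+p*k) := by field_simp; ring
    linarith
  rw [div_le_iff₀ (by positivity)] at this
  linarith

lemma vv_lower {k : ℕ} {p : ℝ} (hp : 0 < p) (hp1 : p < 1) (hk : 0 < k) (hc : (1 + p * k) / k ≤ 1/4) : (k:ℝ)^2 / (128 * (1 + p*k)^2) ≤ vv k p := by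
  have hk' : (0:ℝ) < k := by exact_mod_cast hk
  set c := 1 + p * k with hcdef
  have hc0 : 0 < c := by positivity
  set d := k / (8 * c) with hd
  have hd0 : 0 < d := by positivity
  set e := e1 k p with he
  have he0 : 0 ≤ e := e1_nonneg hp hp1 hk
  have card : (((range k).filter (fun i : ℕ => |(i:ℝ) - e| < d)).card : ℝ) ≤ 2 * d + 1 := by
    have hsub : (range k).filter (fun i : ℕ => |(i:ℝ) - e| < d) ⊆ Finset.Icc ⌈e-d⌉₊ ⌊e+d⌋₊ := by
      intro i hi
      rw [Finset.mem_filter, abs_lt] at hi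
      rw [Finset.mem_Icc]
      exact ⟨Nat.ceil_le.2 (by linarith [hi.2.1]), Nat.le_floor (by linarith [hi.2.2])⟩
    have h1 := Finset.card_le_card hsub
    rw [Nat.card_Icc] at h1
    have h2 : (((range k).filter (fun i : ℕ => |(i:ℝ) - e| < d)).card : ℝ)
        ≤ ((⌊e+d⌋₊ + 1 - ⌈e-d⌉₊ : ℕ) : ℝ) := by exact_mod_cast h1
    refine h2.trans ?_
    rcases Nat.le_total ⌈e-d⌉₊ (⌊e+d⌋₊ + 1) with h | h
    · rw [Nat.cast_sub h]
      push_cast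
      have := Nat.floor_le (a := e + d) (by linarith)
      have := Nat.le_ceil (e - d)
      linarith
    · rw [Nat.sub_eq_zero_of_le h]; simp; linarith
  have near : ∑ i ∈ (range k).filter (fun i : ℕ => |(i:ℝ) - e| < d), om k p i ≤ 1/2 := by
    have h1 := Finset.sum_le_card_nsmul ((range k).filter (fun i : ℕ => |(i:ℝ) - e| < d)) (om k p)
      (c / k) (fun i _ => (om_anti hp hp1 hk (Nat.zero_le i)).trans (om_zero_le hp hp1 hk))
    rw [nsmul_eq_mul] at h1
    have h2 : (((range k).filter (fun i : ℕ => |(i:ℝ) - e| < d)).card : ℝ) * (c/k) ≤ (2*d+1) * (c/k) := by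
      gcongr
    have h3 : (2*d+1) * (c/k) = 1/4 + c/k := by rw [hd]; field_simp; ring
    linarith
  have tot := om_total hp hp1 hk
  rw [← Finset.sum_filter_add_sum_filter_not (range k) (fun i : ℕ => |(i:ℝ) - e| < d)] at tot
  have far : d^2 * ∑ i ∈ (range k).filter (fun i : ℕ => ¬ |(i:ℝ) - e| < d), om k p i ≤ vv k p := by
    rw [Finset.mul_sum]
    calc _ ≤ ∑ i ∈ (range k).filter (fun i : ℕ => ¬ |(i:ℝ) - e| < d), om k p i * ((i:ℝ)-e)^2 := by
          apply Finset.sum_le_sum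
          intro i hi
          have := (Finset.mem_filter.1 hi).2
          push Not at this
          rw [mul_comm]
          apply mul_le_mul_of_nonneg_left _ (om_pos hp hp1 hk i).le
          rw [← sq_abs (_ - e)]; gcongr
      _ ≤ _ := Finset.sum_le_sum_of_subset_of_nonneg (Finset.filter_subset _ _)
          (fun i _ _ => mul_nonneg (om_pos hp hp1 hk i).le (sq_nonneg _))
  have : (k:ℝ)^2 / (128 * c^2) = d^2 * (1/2) := by rw [hd]; field_simp; ring
  rw [this]
  refine le_trans ?_ far
  gcongr
  linarith

lemma varM_lower {k : ℕ} {p : ℝ} (hp : 0 < p) (hp1 : p < 1) (hk : 0 < k) (hk2 : 2 ≤ k) (hc : (1 + p * k) / k ≤ 1/4) :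
    (k:ℝ)^3 / (256 * (1 + p*k)^2) ≤ varM k p := by
  rw [varM_eq hp hp1 hk]
  have h := vv_lower hp hp1 hk hc
  have hk' : (2:ℝ) ≤ k := by exact_mod_cast hk2
  have hn : (k:ℝ)/2 ≤ ((k-1:ℕ):ℝ) := by rw [Nat.cast_sub (by omega)]; push_cast; linarith
  calc (k:ℝ)^3 / (256 * (1 + p*k)^2) = (k/2) * ((k:ℝ)^2 / (128 * (1 + p*k)^2)) := by field_simp; ring
    _ ≤ _ := by gcongr


lemma AA_compare {K k m : ℕ} {p : ℝ} (hp : 0 < p) (hp1 : p < 1) (hK : 0 < K) (hk : k = K + m)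
    (g : ℕ → ℝ) (G : ℝ) (hg0 : ∀ i < k, 0 ≤ g i) (hg : ∀ i < k, g i ≤ G) :
    |AA k p g - AA K p g| ≤ G * (m / k) := by
  have hk0 : 0 < k := by omega
  have hk' : (0:ℝ) < k := by exact_mod_cast hk0
  have dK := denom_pos hp hp1.le hK
  have dk := denom_pos hp hp1.le hk0
  set l := ∑ i ∈ range K, om k p i with hl
  have hle : l = (1 - (1-p)^K) / (1 - (1-p)^k) := om_sum k K
  have hsplit : ∀ f : ℕ → ℝ, ∑ i ∈ range k, f i = ∑ i ∈ range K, f i + ∑ i ∈ range m, f (K+i) := by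
    intro f; rw [hk, Finset.sum_range_add]
  have hom : ∀ i, om k p i = l * om K p i := by
    intro i; rw [hle]; unfold om; field_simp
  have tot := om_total hp hp1 hk0
  have hlow : (K:ℝ) ≤ k * l := by
    have := avg_anti (om k p) (om_anti hp hp1 hk0) K k (by omega)
    rwa [tot, mul_one] at this
  rw [hsplit, ← hl] at tot
  have hR0 : 0 ≤ ∑ i ∈ range m, om k p (K+i) * g (K+i) := Finset.sum_nonneg fun i hi =>
    mul_nonneg (om_pos hp hp1 hk0 _).le (hg0 _ (by have := Finset.mem_range.1 hi; omega))
  have hR1 : ∑ i ∈ range m, om k p (K+i) * g (K+i) ≤ (1 - l) * G := by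
    have : (1 - l) = ∑ i ∈ range m, om k p (K+i) := by linarith
    rw [this, Finset.sum_mul]
    exact Finset.sum_le_sum fun i hi => mul_le_mul_of_nonneg_left
      (hg _ (by have := Finset.mem_range.1 hi; omega)) (om_pos hp hp1 hk0 _).le
  have hA0 : 0 ≤ AA K p g := AA_nonneg hp hp1 hK g fun i hi => hg0 i (by omega)
  have hA1 : AA K p g ≤ G := AA_bound hp hp1 hK g G fun i hi => hg i (by omega)
  have hdec : AA k p g = l * AA K p g + ∑ i ∈ range m, om k p (K+i) * g (K+i) := by
    unfold AA
    rw [hsplit, Finset.mul_sum]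
    congr 1
    apply Finset.sum_congr rfl
    intro i _; rw [hom]; ring
  have hl1 : 0 ≤ 1 - l := by
    have : 0 ≤ ∑ i ∈ range m, om k p (K+i) := Finset.sum_nonneg fun i _ => (om_pos hp hp1 hk0 _).le
    linarith
  have hlm : 1 - l ≤ m / k := by
    rw [le_div_iff₀ hk']
    have : (k:ℝ) = K + m := by rw [hk]; push_cast; ring
    nlinarith
  have hG : 0 ≤ G := hA0.trans hA1
  have h3 : G * (1 - l) ≤ G * (m/k) := mul_le_mul_of_nonneg_left hlm hG
  have h4 : (1-l) * AA K p g ≤ (1-l) * G := mul_le_mul_of_nonneg_left hA1 hl1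
  have h5 : 0 ≤ (1-l) * AA K p g := mul_nonneg hl1 hA0
  rw [hdec, abs_le]
  constructor <;> nlinarith


lemma e1_compare {K k m : ℕ} {p : ℝ} (hp : 0 < p) (hp1 : p < 1) (hK : 0 < K) (hk : k = K + m) : |e1 k p - e1 K p| ≤ m := by
  have hk' : (0:ℝ) < k := by exact_mod_cast (show 0 < k by omega)
  have := AA_compare hp hp1 hK hk (fun i => (i:ℝ)) k (fun i _ => Nat.cast_nonneg i)
    (fun i hi => by exact_mod_cast hi.le)
  have e : (k:ℝ) * (m/k) = m := by field_simp
  rwa [e] at this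

lemma e2_compare {K k m : ℕ} {p : ℝ} (hp : 0 < p) (hp1 : p < 1) (hK : 0 < K) (hk : k = K + m) : |e2 k p - e2 K p| ≤ m * k := by
  have hk' : (0:ℝ) < k := by exact_mod_cast (show 0 < k by omega)
  have := AA_compare hp hp1 hK hk (fun i => (i:ℝ)^2) ((k:ℝ)^2) (fun i _ => by positivity)
    (fun i hi => by gcongr)
  have e : (k:ℝ)^2 * (m/k) = m * k := by field_simp
  rwa [e] at this

lemma vv_compare {K k m : ℕ} {p : ℝ} (hp : 0 < p) (hp1 : p < 1) (hK : 0 < K) (hk : k = K + m) : |vv k p - vv K p| ≤ 3 * (m * k) := by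
  rw [vv_eq hp hp1 hK, vv_eq hp hp1 (show 0 < k by omega)]
  have a1 := e1_compare hp hp1 hK hk
  have a2 := e2_compare hp hp1 hK hk
  have b1 := e1_nonneg hp hp1 hK
  have b2 := e1_nonneg hp hp1 (show 0 < k by omega)
  have b3 := e1_le hp hp1 hK
  have b4 := e1_le hp hp1 (show 0 < k by omega)
  have hKk : (K:ℝ) ≤ k := by exact_mod_cast (show K ≤ k by omega)
  have : |e1 k p ^2 - e1 K p ^2| ≤ m * (2 * k) := by
    have : e1 k p ^2 - e1 K p ^2 = (e1 k p - e1 K p) * (e1 k p + e1 K p) := by ring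
    rw [this, abs_mul]
    apply mul_le_mul a1 _ (abs_nonneg _) (Nat.cast_nonneg _)
    rw [abs_of_nonneg (by linarith)]; linarith
  rw [abs_le] at *
  constructor <;> linarith [a2.1, a2.2, this.1, this.2]

lemma varM_compare {K k m : ℕ} {p : ℝ} (hp : 0 < p) (hp1 : p < 1) (hK : 0 < K) (hk : k = K + m) : |varM k p - varM K p| ≤ 4 * (m * (k:ℝ)^2) := by
  have hk0 : 0 < k := by omega
  rw [varM_eq hp hp1 hK, varM_eq hp hp1 hk0]
  have a1 := vv_compare hp hp1 hK hk
  have a2 := vv_le hp hp1 hk0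
  have a3 : 0 ≤ vv k p := AA_nonneg hp hp1 hk0 _ fun i _ => sq_nonneg _
  have hKk : ((K-1:ℕ):ℝ) ≤ k := by exact_mod_cast (show K-1 ≤ k by omega)
  have e : ((k-1:ℕ):ℝ) = ((K-1:ℕ):ℝ) + m := by exact_mod_cast (show k-1 = K-1+m by omega)
  have : ((k-1:ℕ):ℝ) * vv k p - ((K-1:ℕ):ℝ) * vv K p = m * vv k p + ((K-1:ℕ):ℝ) * (vv k p - vv K p) := by
    rw [e]; ring
  rw [this]
  refine (abs_add_le _ _).trans ?_
  rw [abs_mul, abs_mul, abs_of_nonneg a3, Nat.abs_cast, Nat.abs_cast]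
  have b1 : (m:ℝ) * vv k p ≤ m * (k:ℝ)^2 := by gcongr
  have b2 : ((K-1:ℕ):ℝ) * |vv k p - vv K p| ≤ k * (3 * (m * k)) := by gcongr
  nlinarith

lemma muM_compare {K k m : ℕ} {p : ℝ} (hp : 0 < p) (hp1 : p < 1) (hK : 0 < K) (hk : k = K + m) : |muM k p - ((Nat.choose k 2 : ℝ) - ((k-1 : ℕ):ℝ)
        - (Nat.choose K 2 : ℝ) + ((K-1 : ℕ) : ℝ)) - muM K p| ≤ 2 * (m * k) := by
  have hk0 : 0 < k := by omega
  rw [muM_eq hp hp1 hK, muM_eq hp hp1 hk0]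
  have a1 := e1_compare hp hp1 hK hk
  have a2 := e1_le hp hp1 hk0
  have a3 := e1_nonneg hp hp1 hk0
  have hKk : ((K-1:ℕ):ℝ) ≤ k := by exact_mod_cast (show K-1 ≤ k by omega)
  have e : ((k-1:ℕ):ℝ) = ((K-1:ℕ):ℝ) + m := by exact_mod_cast (show k-1 = K-1+m by omega)
  have : (Nat.choose k 2 : ℝ) - ((k-1 : ℕ):ℝ) - ((k-1:ℕ):ℝ) * e1 k p - ((Nat.choose k 2 : ℝ) - ((k-1 : ℕ):ℝ)
        - (Nat.choose K 2 : ℝ) + ((K-1 : ℕ) : ℝ)) - ((Nat.choose K 2 : ℝ) - ((K-1 : ℕ):ℝ) - ((K-1:ℕ):ℝ) * e1 K p)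
      = - (m * e1 k p + ((K-1:ℕ):ℝ) * (e1 k p - e1 K p)) := by
    rw [e]; ring
  rw [this, abs_neg]
  refine (abs_add_le _ _).trans ?_
  rw [abs_mul, abs_mul, abs_of_nonneg a3, Nat.abs_cast, Nat.abs_cast]
  have b1 : (m:ℝ) * e1 k p ≤ m * k := by gcongr
  have b2 : ((K-1:ℕ):ℝ) * |e1 k p - e1 K p| ≤ k * m := by gcongr
  nlinarith


lemma clt_M (K : ℕ → ℕ) (P us : ℕ → ℝ) (hK : ∀ k, 0 < K k) (hP : ∀ k, 0 < P k)
    (hP1 : ∀ k, P k < 1) (hvar : ∀ k, 0 < varM (K k) (P k))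
    (hd : Tendsto (fun k => (K k : ℝ) / √(varM (K k) (P k))) atTop (𝓝 0)) (u : ℝ)
    (hu : Tendsto us atTop (𝓝 u)) :
    Tendsto (fun k => Pr (K k) (P k) (fun T => (Mval (K k) T : ℝ) ≤ muM (K k) (P k)
      + us k * √(varM (K k) (P k)))) atTop (𝓝 (stdGaussCDF u)) := by
  have h := clt_array (fun k => K k - 1) K (fun k => ww (K k) (P k))
    (fun k a => (e1 (K k) (P k) - (a:ℕ)) / √(varM (K k) (P k)))
    (fun k a => ww_nonneg (hP k) (hP1 k) (hK k) a) (fun k => ww_sum (hP k) (hP1 k) (hK k))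
    (fun k => by
      simp_rw [← mul_div_assoc]
      rw [← Finset.sum_div, cent_zero (hP k) (hP1 k) (hK k), zero_div])
    (fun k => by
      simp_rw [div_pow, ← mul_div_assoc]
      rw [← Finset.sum_div, Real.sq_sqrt (hvar k).le, ← vv_fin (hP k) (hP1 k) (hK k), ← mul_div_assoc,
        ← varM_eq (hP k) (hP1 k) (hK k), div_self (hvar k).ne'])
    (fun k => (K k : ℝ) / √(varM (K k) (P k))) (fun k => u - us k)
    (fun k a => by
      rw [abs_div, abs_of_nonneg (Real.sqrt_nonneg _)]
      apply div_le_div_of_nonneg_right _ (Real.sqrt_nonneg _)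
      have a1 := e1_nonneg (hP k) (hP1 k) (hK k)
      have a2 := e1_le (hP k) (hP1 k) (hK k)
      have a3 : ((a:ℕ):ℝ) ≤ K k := by exact_mod_cast a.2.le
      have a4 : (0:ℝ) ≤ (a:ℕ) := Nat.cast_nonneg _
      rw [abs_le]; constructor <;> linarith) hd (by
      have := (tendsto_const_nhds (x := u)).sub hu
      rwa [sub_self] at this) u
  refine h.congr ?_
  intro k
  rw [Pr_EE]
  congr 1
  funext T
  apply ind_congr
  have hs : 0 < √(varM (K k) (P k)) := Real.sqrt_pos.2 (hvar k)
  have hM := Mval_sub_mu (hP k) (hP1 k) (hK k) T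
  rw [← Finset.sum_div, ← hM]
  constructor
  · intro h
    have : ((Mval (K k) T : ℝ) - muM (K k) (P k)) / √(varM (K k) (P k)) ≤ us k := by linarith
    rw [div_le_iff₀ hs] at this
    linarith
  · intro h
    have : ((Mval (K k) T : ℝ) - muM (K k) (P k)) / √(varM (K k) (P k)) ≤ us k := by
      rw [div_le_iff₀ hs]; linarith
    linarith


lemma wt_nonneg' {k : ℕ} {p : ℝ} (hp : 0 < p) (hp1 : p < 1) (hk : 0 < k) (T : Fin (k-1) → Fin k) :
    0 < wt k p T := by
  have q0 : 0 < 1 - p := by linarith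
  have hd := denom_pos hp hp1.le hk
  unfold wt
  exact Finset.prod_pos fun j _ => by positivity

lemma Pr_total {k : ℕ} {p : ℝ} (hp : 0 < p) (hp1 : p < 1) (hk : 0 < k) :
    Pr k p (fun _ => True) = 1 := by
  rw [Pr_EE]
  have : (fun T : Fin (k-1) → Fin k => ind ((fun _ => True) T)) = fun _ => (1:ℝ) := by
    funext T; exact ind_pos trivial
  rw [this, EE_const (ww_sum hp hp1 hk)]

lemma Pr_split {k : ℕ} {p : ℝ} (A B : (Fin (k-1) → Fin k) → Prop) :
    Pr k p A = Pr k p (fun T => A T ∧ B T) + Pr k p (fun T => A T ∧ ¬ B T) := by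
  unfold Pr
  rw [← Finset.sum_add_distrib]
  apply Finset.sum_congr rfl
  intro T _
  unfold ind
  by_cases a : A T <;> by_cases b : B T <;> simp [a, b]

lemma Pr_congr {k : ℕ} {p : ℝ} {A B : (Fin (k-1) → Fin k) → Prop} (h : ∀ T, A T ↔ B T) :
    Pr k p A = Pr k p B := by
  have : A = B := by funext T; exact propext (h T)
  rw [this]

lemma treeProb_pos {k : ℕ} {p : ℝ} (hp : 0 < p) (hp1 : p < 1) (hk : 0 < k) : 0 < treeProb k p := by
  unfold treeProb
  refine Finset.sum_pos' (fun T _ => mul_nonneg (wt_nonneg' hp hp1 hk T).le (ind_nonneg _))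
    ⟨fun _ => ⟨0, hk⟩, Finset.mem_univ _, ?_⟩
  rw [ind_pos, mul_one]
  · exact wt_nonneg' hp hp1 hk _
  · intro t h1 h2
    have : (Finset.univ.filter (fun j : Fin (k-1) => ((((fun _ => ⟨0, hk⟩) : Fin (k-1) → Fin k) j : ℕ) < t))) = Finset.univ :=
      Finset.filter_true_of_mem (fun j _ => show 0 < t by omega)
    rw [this]
    simpa using h2

lemma cond_eq {k : ℕ} {p : ℝ} (hp : 0 < p) (hp1 : p < 1) (hk : 0 < k) (x : ℝ) :
    condCDF_M k p x = 1 - Pr k p (fun T => TREEevt k T ∧ x < (Mval k T:ℝ)) / treeProb k p := by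
  have ht := treeProb_pos hp hp1 hk
  have h := Pr_split (p := p) (TREEevt k) (fun T => (Mval k T:ℝ) ≤ x)
  rw [← treeProb_Pr] at h
  simp_rw [not_le] at h
  have : condCDF_M k p x = Pr k p (fun T => TREEevt k T ∧ (Mval k T:ℝ) ≤ x) / treeProb k p := rfl
  rw [this, eq_sub_iff_add_eq, ← add_div, ← h, div_self ht.ne']

lemma Pr_gt {k : ℕ} {p : ℝ} (hp : 0 < p) (hp1 : p < 1) (hk : 0 < k) (x : ℝ) :
    Pr k p (fun T => x < (Mval k T:ℝ)) = 1 - Pr k p (fun T => (Mval k T:ℝ) ≤ x) := by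
  have h := Pr_split (k := k) (p := p) (fun _ => True) (fun T => (Mval k T:ℝ) ≤ x)
  rw [Pr_total hp hp1 hk] at h
  simp_rw [not_le, true_and] at h
  linarith

lemma cond_upper {k : ℕ} {p : ℝ} (hp : 0 < p) (hp1 : p < 1) (hk : 0 < k) (x : ℝ) :
    condCDF_M k p x ≤ Pr k p (fun T => (Mval k T:ℝ) ≤ x) := by
  have ht := treeProb_pos hp hp1 hk
  have h := fkg_lower hp hp1.le hk x
  rw [Pr_total hp hp1 hk, one_mul, Pr_gt hp hp1 hk] at h
  rw [cond_eq hp hp1 hk]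
  have : 1 - Pr k p (fun T => (Mval k T:ℝ) ≤ x) ≤
      Pr k p (fun T => TREEevt k T ∧ x < (Mval k T:ℝ)) / treeProb k p := by
    rw [le_div_iff₀ ht]; linarith
  linarith

lemma Pr_nonneg' {k : ℕ} {p : ℝ} (hp : 0 < p) (hp1 : p < 1) (hk : 0 < k)
    (A : (Fin (k-1) → Fin k) → Prop) : 0 ≤ Pr k p A :=
  Finset.sum_nonneg fun T _ => mul_nonneg (wt_nonneg' hp hp1 hk T).le (ind_nonneg _)

lemma cond_lower {K m : ℕ} {p : ℝ} (hp : 0 < p) (hp1 : p < 1) (hK : 0 < K) (x g : ℝ)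
    (hg : 0 < g) (hG : g ≤ Pr K p (GoodEvt K m)) :
    1 - (1 - Pr K p (fun T => (Mval K T:ℝ) ≤ x - ((Nat.choose (K+m) 2:ℝ) - ((K+m-1:ℕ):ℝ)
      - (Nat.choose K 2:ℝ) + ((K-1:ℕ):ℝ)))) / g ≤ condCDF_M (K+m) p x := by
  have hk : 0 < K + m := by omega
  have ht := treeProb_pos hp hp1 hk
  have h := fkg_upper (m := m) hp hp1.le hK x
  rw [Pr_gt hp hp1 hK] at h
  rw [cond_eq hp hp1 hk]
  have h0 := Pr_nonneg' hp hp1 hk (fun T => TREEevt (K+m) T ∧ x < (Mval (K+m) T:ℝ))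
  have : Pr (K+m) p (fun T => TREEevt (K+m) T ∧ x < (Mval (K+m) T:ℝ)) / treeProb (K+m) p ≤
     (1 - Pr K p (fun T => (Mval K T:ℝ) ≤ x - ((Nat.choose (K+m) 2:ℝ) - ((K+m-1:ℕ):ℝ)
      - (Nat.choose K 2:ℝ) + ((K-1:ℕ):ℝ)))) / g := by
    rw [div_le_div_iff₀ ht hg]
    have := mul_le_mul_of_nonneg_left hG h0
    linarith
  linarith

lemma var_low {k K : ℕ} {p : ℝ} (hp : 0 < p) (hp1 : p < 1) (hK2 : 2 ≤ K) (hKk : K ≤ k) (hkK : k ≤ 2 * K)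
    (hs : (1 + p * k) / k ≤ 1/8) : 0 < varM K p ∧
    (k:ℝ) ≤ 46 * ((1 + p * k) / √k) * √(varM K p) := by
  have hK0 : (0:ℝ) < K := by exact_mod_cast (show 0 < K by omega)
  have hk0 : (0:ℝ) < k := by exact_mod_cast (show 0 < k by omega)
  have a1 : (K:ℝ) ≤ k := by exact_mod_cast hKk
  have a2 : (k:ℝ) ≤ 2 * K := by exact_mod_cast hkK
  have b : 1 + p * K ≤ 1 + p * k := by gcongr
  have h := varM_lower hp hp1 (show 0 < K by omega) hK2 (by
    rw [div_le_iff₀ hk0] at hs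
    rw [div_le_iff₀ hK0]
    linarith)
  have hpos : 0 < (K:ℝ)^3 / (256 * (1 + p * K)^2) := by positivity
  refine ⟨hpos.trans_le h, ?_⟩
  have c : (k:ℝ)^3 / (2048 * (1 + p * k)^2) ≤ varM K p := by
    refine le_trans ?_ h
    have : (k:ℝ)^3 / 8 ≤ (K:ℝ)^3 := by
      have : (k:ℝ)^3 ≤ (2*K)^3 := by gcongr
      linarith [this, mul_pow (2:ℝ) K 3]
    calc (k:ℝ)^3 / (2048 * (1 + p * k)^2) = ((k:ℝ)^3/8) / (256 * (1 + p * k)^2) := by field_simp; norm_num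
      _ ≤ (K:ℝ)^3 / (256 * (1 + p * K)^2) := by gcongr
  apply le_of_sq_le_sq _ (by positivity)
  rw [mul_pow, mul_pow, div_pow, Real.sq_sqrt hk0.le, Real.sq_sqrt (hpos.trans_le h).le]
  rw [div_le_iff₀ (by positivity)] at c
  have e : (46:ℝ)^2 * ((1 + p * k)^2 / k) * varM K p = (2116 * (varM K p * (1 + p * k)^2)) / k := by
    field_simp; ring
  rw [e, le_div_iff₀ hk0]
  have : 0 ≤ varM K p * (1 + p * k)^2 := mul_nonneg (hpos.trans_le h).le (sq_nonneg _)
  nlinarith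

lemma good_low {h m k : ℕ} {p : ℝ} (hh : 0 < h) (hm : 0 < m) (hp : 0 < p) (hp1 : p < 1)
    (hk : k ≤ 4 * h) (hk0 : 0 < k) :
    1 - (4 / (m:ℝ) + 16 / (p * k * m)) ≤ Pr (2*h) p (GoodEvt (2*h) m) := by
  refine le_trans ?_ (good_prob hh hm hp hp1)
  have h0 : (0:ℝ) < h := by exact_mod_cast hh
  have m0 : (0:ℝ) < m := by exact_mod_cast hm
  have k0 : (0:ℝ) < k := by exact_mod_cast hk0
  have hk' : (k:ℝ) ≤ 4 * h := by exact_mod_cast hk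
  have b := pow_bound hp hp1 hh h
  have c : p * h / (1 + p * h) ≤ 1 - (1-p)^h := by
    have : p * h / (1 + p * h) = 1 - 1 / (1 + p*h) := by field_simp; ring
    rw [this]; linarith
  have c0 : 0 < p * h / (1 + p * h) := by positivity
  have : 4 / ((1-(1-p)^h) * m) ≤ 4 / (m:ℝ) + 16 / (p * k * m) := by
    calc 4 / ((1-(1-p)^h) * m) ≤ 4 / ((p * h / (1 + p * h)) * m) := by gcongr
      _ = 4 / (m:ℝ) + 16 / (p * (4 * h) * m) := by field_simp; ring
      _ ≤ _ := by gcongr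
  linarith


lemma core (k h m : ℕ → ℕ) (P : ℕ → ℝ) (hh : ∀ n, 0 < h n) (hm : ∀ n, 0 < m n)
    (hk : ∀ n, k n = 2 * h n + m n) (h2m : ∀ n, 2 * m n ≤ k n)
    (hP : ∀ n, 0 < P n) (hP1 : ∀ n, P n < 1)
    (t1 : Tendsto (fun n => (m n : ℝ)) atTop atTop)
    (t2 : Tendsto (fun n => P n * k n * m n) atTop atTop)
    (t3 : Tendsto (fun n => (m n : ℝ) * ((1 + P n * k n) / √(k n))) atTop (𝓝 0))
    (hs : ∀ n, (1 + P n * k n) / k n ≤ 1/8) (u : ℝ) :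
    Tendsto (fun n => condCDF_M (k n) (P n) (muM (k n) (P n) + u * √(varM (k n) (P n)))) atTop
      (𝓝 (stdGaussCDF u)) := by
  have hk0 : ∀ n, 0 < k n := fun n => by have := hk n; have := hm n; omega
  have hk0' : ∀ n, (0:ℝ) < k n := fun n => by exact_mod_cast hk0 n
  have hK0 : ∀ n, 0 < 2 * h n := fun n => by have := hh n; omega
  have hm1 : ∀ n, (1:ℝ) ≤ m n := fun n => by exact_mod_cast hm n
  have v1 := fun n => var_low (k := k n) (K := k n) (hP n) (hP1 n)
    (by have := hk n; have := hh n; omega) le_rfl (by omega) (hs n)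
  have v2 := fun n => var_low (k := k n) (K := 2 * h n) (hP n) (hP1 n)
    (by have := hh n; omega) (by have := hk n; omega) (by have := hk n; have := h2m n; omega) (hs n)
  set s : ℕ → ℝ := fun n => (1 + P n * k n) / √(k n) with hsdef
  have s0 : ∀ n, 0 < s n := fun n => by
    have := hk0' n; have := hP n; simp only [hsdef]; positivity
  set S : ℕ → ℝ := fun n => √(varM (k n) (P n)) with hS
  set Q : ℕ → ℝ := fun n => √(varM (2 * h n) (P n)) with hQ
  have S0 : ∀ n, 0 < S n := fun n => Real.sqrt_pos.2 (v1 n).1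
  have Q0 : ∀ n, 0 < Q n := fun n => Real.sqrt_pos.2 (v2 n).1
  have kS : ∀ n, (k n : ℝ) ≤ 46 * s n * S n := fun n => (v1 n).2
  have kQ : ∀ n, (k n : ℝ) ≤ 46 * s n * Q n := fun n => (v2 n).2
  have ts : Tendsto s atTop (𝓝 0) := by
    refine squeeze_zero (fun n => (s0 n).le) (fun n => ?_) t3
    exact le_mul_of_one_le_left (s0 n).le (hm1 n)
  have ts46 : Tendsto (fun n => 46 * s n) atTop (𝓝 0) := by simpa using ts.const_mul 46
  have d1 : Tendsto (fun n => (k n : ℝ) / S n) atTop (𝓝 0) := by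
    refine squeeze_zero (fun n => div_nonneg (hk0' n).le (S0 n).le) (fun n => ?_) ts46
    rw [div_le_iff₀ (S0 n)]; exact kS n
  have d2 : Tendsto (fun n => ((2 * h n : ℕ) : ℝ) / Q n) atTop (𝓝 0) := by
    refine squeeze_zero (fun n => div_nonneg (Nat.cast_nonneg _) (Q0 n).le) (fun n => ?_) ts46
    rw [div_le_iff₀ (Q0 n)]
    refine le_trans ?_ (kQ n)
    exact_mod_cast (show 2 * h n ≤ k n by have := hk n; omega)
  -- upper bound
  have up := clt_M k P (fun _ => u) hk0 hP hP1 (fun n => (v1 n).1) d1 u tendsto_const_nhds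
  -- shift
  set b : ℕ → ℝ := fun n => (Nat.choose (k n) 2 : ℝ) - ((k n - 1 : ℕ):ℝ)
        - (Nat.choose (2 * h n) 2 : ℝ) + ((2 * h n - 1 : ℕ) : ℝ) with hb
  have mc := fun n => muM_compare (hP n) (hP1 n) (hK0 n) (hk n)
  have vc := fun n => varM_compare (hP n) (hP1 n) (hK0 n) (hk n)
  have mu0 : Tendsto (fun n => (muM (k n) (P n) - b n - muM (2 * h n) (P n)) / Q n) atTop (𝓝 0) := by
    apply squeeze_zero_norm (a := fun n => 92 * (m n * s n))
    · intro n
      rw [Real.norm_eq_abs, abs_div, abs_of_pos (Q0 n), div_le_iff₀ (Q0 n)]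
      refine (mc n).trans ?_
      have := mul_le_mul_of_nonneg_left (kQ n) (zero_le_one.trans (hm1 n))
      linarith
    · simpa using t3.const_mul 92
  have rat : Tendsto (fun n => S n / Q n) atTop (𝓝 1) := by
    have r0 : Tendsto (fun n => varM (k n) (P n) / varM (2 * h n) (P n) - 1) atTop (𝓝 0) := by
      apply squeeze_zero_norm (a := fun n => 8464 * (m n * s n)^2)
      · intro n
        have e : varM (k n) (P n) / varM (2 * h n) (P n) - 1 =
          (varM (k n) (P n) - varM (2 * h n) (P n)) / varM (2 * h n) (P n) := by
          have := (v2 n).1.ne'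
          field_simp
        rw [e, Real.norm_eq_abs, abs_div, abs_of_pos (v2 n).1, div_le_iff₀ (v2 n).1]
        refine (vc n).trans ?_
        have q2 : Q n ^ 2 = varM (2 * h n) (P n) := Real.sq_sqrt (v2 n).1.le
        rw [← q2]
        have a : (k n : ℝ)^2 ≤ (46 * s n * Q n)^2 := by
          have := kQ n; have := hk0' n; gcongr
        have a' : (m n : ℝ) * (k n : ℝ)^2 ≤ m n * (46 * s n * Q n)^2 :=
          mul_le_mul_of_nonneg_left a (Nat.cast_nonneg _)
        have c : (m n : ℝ) * (46 * s n * Q n)^2 ≤ (m n:ℝ)^2 * (46 * s n * Q n)^2 := by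
          apply mul_le_mul_of_nonneg_right _ (sq_nonneg _)
          nlinarith [hm1 n]
        nlinarith
      · simpa using (t3.pow 2).const_mul 8464
    have r1 : Tendsto (fun n => varM (k n) (P n) / varM (2 * h n) (P n)) atTop (𝓝 1) := by
      simpa using r0.add_const 1
    have := (Real.continuous_sqrt.tendsto 1).comp r1
    rw [Real.sqrt_one] at this
    refine this.congr fun n => ?_
    simp only [Function.comp]
    rw [Real.sqrt_div (v1 n).1.le]
  have us : Tendsto (fun n => (muM (k n) (P n) - b n - muM (2 * h n) (P n)) / Q n + u * (S n / Q n))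
      atTop (𝓝 u) := by
    simpa using mu0.add (rat.const_mul u)
  have lo := clt_M (fun n => 2 * h n) P _ hK0 hP hP1 (fun n => (v2 n).1) d2 u us
  -- good event
  set g : ℕ → ℝ := fun n => 1 - (4 / (m n:ℝ) + 16 / (P n * k n * m n)) with hg
  have tg : Tendsto g atTop (𝓝 1) := by
    have a := t1.const_div_atTop 4
    have c := t2.const_div_atTop 16
    simpa using (tendsto_const_nhds (x := (1:ℝ))).sub (a.add c)
  have lo' := (tendsto_const_nhds (x := (1:ℝ))).sub
    (((tendsto_const_nhds (x := (1:ℝ))).sub lo).div tg one_ne_zero)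
  have e : (1:ℝ) - (1 - stdGaussCDF u) / 1 = stdGaussCDF u := by ring
  rw [e] at lo'
  refine tendsto_of_tendsto_of_tendsto_of_le_of_le' lo' up ?_ ?_
  · filter_upwards [tg.eventually_const_lt (show (0:ℝ) < 1 by norm_num)] with n hgn
    have := cond_lower (m := m n) (hP n) (hP1 n) (hK0 n) (muM (k n) (P n) + u * S n) (g n) hgn
      (good_low (hh n) (hm n) (hP n) (hP1 n) (by have := hk n; have := h2m n; omega) (hk0 n))
    rw [← hk n] at this
    refine le_trans (le_of_eq ?_) this
    have e2 : muM (2 * h n) (P n) + ((muM (k n) (P n) - b n - muM (2 * h n) (P n)) / Q n + u * (S n / Q n)) * Q n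
      = muM (k n) (P n) + u * S n - b n := by
      have := (Q0 n).ne'
      field_simp
      ring
    simp only [Pi.div_apply]
    rw [e2]
  · exact Eventually.of_forall fun n => cond_upper (hP n) (hP1 n) (hk0 n) _


theorem Mstar_clt (p : ℕ → ℝ)
    (hp01 : ∀ k, p k ∈ Set.Ioc (0:ℝ) 1)
    (hlow : Tendsto (fun k : ℕ => p k * (k:ℝ) ^ ((3:ℝ)/2)) atTop atTop)
    (hup : ∀ᶠ k : ℕ in atTop, p k ≤ 10 * Real.log k / k) (u : ℝ) :
    Tendsto (fun k : ℕ => condCDF_M k (p k) (muM k (p k) + u * Real.sqrt (varM k (p k))))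
      atTop (𝓝 (stdGaussCDF u)) := by
  have tk : Tendsto (fun k : ℕ => (k:ℝ)) atTop atTop := tendsto_natCast_atTop_atTop
  have tsk : Tendsto (fun k : ℕ => √(k:ℝ)) atTop atTop := Real.tendsto_sqrt_atTop.comp tk
  have hp0 : ∀ k, 0 < p k := fun k => (hp01 k).1
  have logs : Tendsto (fun k : ℕ => Real.log k / √(k:ℝ)) atTop (𝓝 0) := by
    have h := (isLittleO_log_rpow_atTop (r := 1/2) (by norm_num)).tendsto_div_nhds_zero
    refine (h.comp tk).congr fun k => ?_
    simp [Function.comp, Real.sqrt_eq_rpow]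
  have pks : Tendsto (fun k : ℕ => p k * k / √(k:ℝ)) atTop (𝓝 0) := by
    have l10 : Tendsto (fun k : ℕ => 10 * (Real.log k / √(k:ℝ))) atTop (𝓝 0) := by
      simpa using logs.const_mul 10
    refine squeeze_zero' (Eventually.of_forall fun k => ?_) ?_ l10
    · have := hp0 k; positivity
    · filter_upwards [hup, eventually_gt_atTop 0] with k hk k0
      have k0' : (0:ℝ) < k := by exact_mod_cast k0
      rw [← mul_div_assoc]
      apply div_le_div_of_nonneg_right _ (Real.sqrt_nonneg _)
      rwa [le_div_iff₀ k0'] at hk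
  have isk : Tendsto (fun k : ℕ => 1 / √(k:ℝ)) atTop (𝓝 0) := tsk.const_div_atTop 1
  have iom : Tendsto (fun k : ℕ => 1 / (p k * k * √(k:ℝ))) atTop (𝓝 0) := by
    refine (hlow.const_div_atTop 1).congr' ?_
    filter_upwards [eventually_gt_atTop 0] with k k0
    have k0' : (0:ℝ) < k := by exact_mod_cast k0
    rw [show (3:ℝ)/2 = 1 + 1/2 by norm_num, Real.rpow_add k0', Real.rpow_one, Real.sqrt_eq_rpow,
      mul_assoc]
  set s : ℕ → ℝ := fun k => (1 + p k * k) / √(k:ℝ) with hs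
  have ts : Tendsto s atTop (𝓝 0) := by
    have := isk.add pks
    rw [add_zero] at this
    refine this.congr fun k => ?_
    rw [← add_div]
  -- ratio of the two scales
  set R : ℕ → ℝ := fun k => √(k:ℝ) * (p k * k) / (1 + p k * k)^2 with hR
  have Rpos : ∀ k : ℕ, 0 < k → 0 < R k := fun k k0 => by
    have k0' : (0:ℝ) < k := by exact_mod_cast k0
    have := hp0 k
    simp only [hR]; positivity
  have iR : Tendsto (fun k => (R k)⁻¹) atTop (𝓝 0) := by
    have := (iom.add (isk.const_mul 2)).add pks
    simp only [mul_zero, add_zero] at this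
    refine this.congr' ?_
    filter_upwards [eventually_gt_atTop 0] with k k0
    have k0' : (0:ℝ) < k := by exact_mod_cast k0
    have := hp0 k
    have hsq : 0 < √(k:ℝ) := Real.sqrt_pos.2 k0'
    simp only [hR]
    generalize √(k:ℝ) = r at *
    field_simp
    ring
  have tR : Tendsto R atTop atTop := by
    have h : Tendsto (fun k => (R k)⁻¹) atTop (𝓝[>] 0) := by
      rw [tendsto_nhdsWithin_iff]
      refine ⟨iR, ?_⟩
      filter_upwards [eventually_gt_atTop 0] with k k0
      exact inv_pos.2 (Rpos k k0)
    refine h.inv_tendsto_nhdsGT_zero.congr fun k => ?_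
    simp only [Pi.inv_apply, inv_inv]
  have tsR : Tendsto (fun k => √(R k)) atTop atTop := Real.tendsto_sqrt_atTop.comp tR
  set m0 : ℕ → ℝ := fun k => (1 + p k * k) / (p k * k) * √(R k) with hm0
  set m : ℕ → ℕ := fun k => ⌊m0 k⌋₊ + 1 + (k + ⌊m0 k⌋₊ + 1) % 2 with hmdef
  have m_lo : ∀ k, m0 k ≤ m k := fun k => by
    have h1 := (Nat.lt_floor_add_one (m0 k)).le
    have h2 : ((⌊m0 k⌋₊ + 1 : ℕ) : ℝ) ≤ m k := by exact_mod_cast Nat.le_add_right _ _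
    push_cast at h2; linarith
  have m0_nn : ∀ k, 0 ≤ m0 k := fun k => by
    have := hp0 k; simp only [hm0]; positivity
  have m_hi : ∀ k, (m k : ℝ) ≤ m0 k + 2 := fun k => by
    have h1 := Nat.floor_le (m0_nn k)
    have h2 : (m k : ℝ) ≤ ((⌊m0 k⌋₊ + 2 : ℕ) : ℝ) := by
      have : m k ≤ ⌊m0 k⌋₊ + 2 := by
        simp only [hmdef]
        have := Nat.mod_lt (k + ⌊m0 k⌋₊ + 1) (show 0 < 2 by norm_num)
        omega
      exact_mod_cast this
    push_cast at h2; linarith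
  have m_pos : ∀ k, 0 < m k := fun k => by simp only [hmdef]; omega
  have m_par : ∀ k, (k + m k) % 2 = 0 := fun k => by simp only [hmdef]; omega
  have pm0 : ∀ k : ℕ, 0 < k → p k * k * m0 k = (1 + p k * k) * √(R k) := fun k k0 => by
    have k0' : (0:ℝ) < k := by exact_mod_cast k0
    have := hp0 k
    simp only [hm0]; field_simp
  have m0_R : ∀ k : ℕ, 0 < k → √(R k) ≤ m0 k := fun k k0 => by
    have k0' : (0:ℝ) < k := by exact_mod_cast k0
    have := hp0 k
    simp only [hm0]
    apply le_mul_of_one_le_left (Real.sqrt_nonneg _)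
    rw [le_div_iff₀ (by positivity)]; linarith
  have t1 : Tendsto (fun k => (m k : ℝ)) atTop atTop := by
    refine tendsto_atTop_mono' _ ?_ tsR
    filter_upwards [eventually_gt_atTop 0] with k k0
    exact (m0_R k k0).trans (m_lo k)
  have t2 : Tendsto (fun k : ℕ => p k * k * m k) atTop atTop := by
    refine tendsto_atTop_mono' _ ?_ tsR
    filter_upwards [eventually_gt_atTop 0] with k k0
    have := hp0 k
    calc √(R k) ≤ (1 + p k * k) * √(R k) := by
          apply le_mul_of_one_le_left (Real.sqrt_nonneg _)
          have : 0 ≤ p k * k := by positivity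
          linarith
      _ = p k * k * m0 k := (pm0 k k0).symm
      _ ≤ p k * k * m k := by have := m_lo k; gcongr
  have t3 : Tendsto (fun k : ℕ => (m k : ℝ) * ((1 + p k * k) / √(k:ℝ))) atTop (𝓝 0) := by
    have hh : Tendsto (fun k => 1 / √(R k) + 2 * s k) atTop (𝓝 0) := by
      simpa using (tsR.const_div_atTop 1).add (ts.const_mul 2)
    refine squeeze_zero' (Eventually.of_forall fun k => ?_) ?_ hh
    · have := hp0 k; positivity
    · filter_upwards [eventually_gt_atTop 0] with k k0
      have k0' : (0:ℝ) < k := by exact_mod_cast k0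
      have pk := hp0 k
      have hr := Rpos k k0
      have s0 : 0 ≤ s k := by simp only [hs]; positivity
      have e : m0 k * s k = 1 / √(R k) := by
        have e1 : (1 + p k * k) / (p k * k) * s k = 1 / R k := by
          have hsq : 0 < √(k:ℝ) := Real.sqrt_pos.2 k0'
          simp only [hs, hR]
          generalize √(k:ℝ) = r at *
          field_simp
        have e2 : m0 k * s k = ((1 + p k * k) / (p k * k) * s k) * √(R k) := by
          simp only [hm0]; ring
        rw [e2, e1]
        have h3 := Real.sq_sqrt hr.le
        have h4 : 0 < √(R k) := Real.sqrt_pos.2 hr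
        rw [div_mul_eq_mul_div, one_mul, div_eq_div_iff hr.ne' h4.ne']
        nlinarith
      calc (m k : ℝ) * s k ≤ (m0 k + 2) * s k := by have := m_hi k; gcongr
        _ = 1 / √(R k) + 2 * s k := by rw [add_mul, e]
  -- everything holds eventually
  have ev1 : ∀ᶠ k : ℕ in atTop, p k < 1 := by
    have h := pks.eventually_lt_const (show (0:ℝ) < 1 by norm_num)
    filter_upwards [h, eventually_gt_atTop 0] with k hk k0
    have k1 : (1:ℝ) ≤ k := by exact_mod_cast k0
    have hsq : 0 < √(k:ℝ) := Real.sqrt_pos.2 (by linarith)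
    rw [div_lt_one hsq] at hk
    have : √(k:ℝ) ≤ k := (Real.sqrt_le_sqrt (by nlinarith : (k:ℝ) ≤ (k:ℝ)^2)).trans (le_of_eq (Real.sqrt_sq (by linarith)))
    nlinarith [hp0 k]
  have ev2 : ∀ᶠ k : ℕ in atTop, (1 + p k * k) / k ≤ 1/8 := by
    filter_upwards [ts.eventually_lt_const (show (0:ℝ) < 1/8 by norm_num), eventually_gt_atTop 0] with k hk k0
    have k1 : (1:ℝ) ≤ k := by exact_mod_cast k0
    have hsq : 0 < √(k:ℝ) := Real.sqrt_pos.2 (by linarith)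
    have : √(k:ℝ) ≤ k := (Real.sqrt_le_sqrt (by nlinarith : (k:ℝ) ≤ (k:ℝ)^2)).trans (le_of_eq (Real.sqrt_sq (by linarith)))
    have pk := hp0 k
    refine le_trans ?_ hk.le
    simp only [hs]
    gcongr
  have ev3 : ∀ᶠ k : ℕ in atTop, 2 * m k ≤ k := by
    filter_upwards [t3.eventually_lt_const (show (0:ℝ) < 1/2 by norm_num), eventually_gt_atTop 0] with k hk k0
    have k1 : (1:ℝ) ≤ k := by exact_mod_cast k0
    have hsq : 0 < √(k:ℝ) := Real.sqrt_pos.2 (by linarith)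
    have h5 : √(k:ℝ) ≤ k := (Real.sqrt_le_sqrt (by nlinarith : (k:ℝ) ≤ (k:ℝ)^2)).trans (le_of_eq (Real.sqrt_sq (by linarith)))
    have pk := hp0 k
    rw [← mul_div_assoc, div_lt_iff₀ hsq] at hk
    have : 0 ≤ (m k : ℝ) * (p k * k) := by positivity
    have : 2 * (m k : ℝ) ≤ k := by nlinarith
    exact_mod_cast this
  obtain ⟨N, hN⟩ := eventually_atTop.1 (ev1.and (ev2.and (ev3.and (eventually_ge_atTop 2))))
  have sh : Tendsto (fun n : ℕ => n + N) atTop atTop := tendsto_add_atTop_nat N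
  rw [← tendsto_add_atTop_iff_nat N]
  refine core (fun n => n + N) (fun n => (n + N - m (n+N)) / 2) (fun n => m (n+N)) (fun n => p (n+N))
    (fun n => ?_) (fun n => m_pos _) (fun n => ?_) (fun n => ?_) (fun n => hp0 _) (fun n => ?_)
    (t1.comp sh) (t2.comp sh) (t3.comp sh) (fun n => ?_) u
  · have a := hN (n+N) (by omega)
    have b := m_par (n+N)
    have c := m_pos (n+N)
    have d := a.2.2.1
    have e := a.2.2.2
    show 0 < (n + N - m (n+N)) / 2
    omega
  · have a := hN (n+N) (by omega)
    have b := m_par (n+N)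
    have d := a.2.2.1
    show n + N = 2 * ((n + N - m (n+N)) / 2) + m (n+N)
    omega
  · exact (hN (n+N) (by omega)).2.2.1
  · exact (hN (n+N) (by omega)).1
  · exact (hN (n+N) (by omega)).2.1
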